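/- arXiv:1304.3894 — 3 statements merged into one kernel-verified Lean document; each statement's English description precedes it below -/
import Mathlib

section
/- Let P be a pencil of quadratic forms q_1, q_2 in n variables over a field F_v which is the residue field of the completion of a number field at a non-archimedean place, with #F_v ≥ n. Suppose r = r(P) < R = R(P), and that either r is even or r ≤ R - 2. Then r ≥ 2. Moreover, if rank(q_1) = r then one can make an invertible change of variables over F_v so that q_1 = q_3(X_1,...,X_{R-2}) + X_{R-1} ℓ(X_1,...,X_{R-1}) and q_2 = q_4(X_1,...,X_{R-2}) + X_{R-1} X_R, where rank(q_3) = r(q_3,q_4) = r - 2 and R(q_3,q_4) equals R - 3 or R - 2; in particular, if r = 2 then q_3 and q_4 vanish identically. -/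
open MvPolynomial NumberField IsDedekindDomain

/-- Substitution `q(T·X)` for a matrix `T`. -/
noncomputable def substMat {K : Type*} [CommRing K] {n : ℕ}
    (T : Matrix (Fin n) (Fin n) K) (q : MvPolynomial (Fin n) K) : MvPolynomial (Fin n) K :=
  MvPolynomial.aeval (fun i => ∑ j, MvPolynomial.C (T i j) * MvPolynomial.X j) q

/-- `q` is a function of the variables `X_0, …, X_{m-1}` alone. -/
def DependsOnlyOnFirst {K : Type*} [CommRing K] {n : ℕ} (m : ℕ)
    (q : MvPolynomial (Fin n) K) : Prop :=
  ∀ i ∈ q.vars, (i : ℕ) < m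

/-- The rank of a quadratic form: the least `m` such that an invertible linear change of
variables makes it a function of the first `m` variables alone. -/
noncomputable def qRank {K : Type*} [Field K] {n : ℕ} (q : MvPolynomial (Fin n) K) : ℕ :=
  sInf {m | ∃ T : Matrix (Fin n) (Fin n) K, IsUnit T.det ∧ DependsOnlyOnFirst m (substMat T q)}

/-- The polynomial `X_0X_1 + X_2X_3 + ⋯ + X_{2m-2}X_{2m-1}` (a sum of `m` hyperbolic planes). -/
noncomputable def hypSum (n m : ℕ) (K : Type*) [CommRing K] : MvPolynomial (Fin n) K :=
  ∑ i ∈ Finset.range m,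
    if h : 2 * i + 1 < n then
      MvPolynomial.X (⟨2 * i, by omega⟩ : Fin n) * MvPolynomial.X (⟨2 * i + 1, h⟩ : Fin n)
    else 0

/-- A quadratic form in `n` variables splits off (at least) `m` hyperbolic planes: an invertible
change of variables puts it in the shape `X_0X_1 + ⋯ + X_{2m-2}X_{2m-1} + Q'(X_{2m},…,X_{n-1})`. -/
def SplitsOffHyperbolics {K : Type*} [Field K] {n : ℕ} (m : ℕ)
    (Q : MvPolynomial (Fin n) K) : Prop :=
  2 * m ≤ n ∧ ∃ T : Matrix (Fin n) (Fin n) K, IsUnit T.det ∧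
    ∃ Q' : MvPolynomial (Fin n) K, (∀ i ∈ Q'.vars, 2 * m ≤ (i : ℕ)) ∧
      substMat T Q = hypSum n m K + Q'

/-- The intersection of the two quadrics `Q₁ = Q₂ = 0` is nonsingular: the `2 × n` matrix of
partial derivatives has rank `2` at every nonzero point over the algebraic closure. -/
def NonsingularIntersection {K : Type*} [Field K] {n : ℕ}
    (Q₁ Q₂ : MvPolynomial (Fin n) K) : Prop :=
  ∀ x : Fin n → AlgebraicClosure K, x ≠ 0 →
    Matrix.rank (Matrix.of fun (i : Fin 2) (j : Fin n) =>
      MvPolynomial.eval x (MvPolynomial.pderiv j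
        (MvPolynomial.map (algebraMap K (AlgebraicClosure K)) (if i = 0 then Q₁ else Q₂)))) = 2

/-- `r(q₁,q₂)`: the maximal rank of a nontrivial form in the pencil, over the algebraic
closure. -/
noncomputable def pencilRmax {K : Type*} [Field K] {n : ℕ}
    (q₁ q₂ : MvPolynomial (Fin n) K) : ℕ :=
  sSup {m | ∃ a b : AlgebraicClosure K, (a ≠ 0 ∨ b ≠ 0) ∧
    m = qRank (MvPolynomial.C a * MvPolynomial.map (algebraMap K (AlgebraicClosure K)) q₁ +
      MvPolynomial.C b * MvPolynomial.map (algebraMap K (AlgebraicClosure K)) q₂)}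

/-- `r_min(q₁,q₂)`: the minimal rank of a nontrivial form in the pencil, over the algebraic
closure. -/
noncomputable def pencilRmin {K : Type*} [Field K] {n : ℕ}
    (q₁ q₂ : MvPolynomial (Fin n) K) : ℕ :=
  sInf {m | ∃ a b : AlgebraicClosure K, (a ≠ 0 ∨ b ≠ 0) ∧
    m = qRank (MvPolynomial.C a * MvPolynomial.map (algebraMap K (AlgebraicClosure K)) q₁ +
      MvPolynomial.C b * MvPolynomial.map (algebraMap K (AlgebraicClosure K)) q₂)}

/-- `R(q₁,q₂)`: the least `m` such that an invertible change of variables over `K` makes every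
form in the pencil (over the algebraic closure) a function of the first `m` variables alone. -/
noncomputable def pencilR {K : Type*} [Field K] {n : ℕ}
    (q₁ q₂ : MvPolynomial (Fin n) K) : ℕ :=
  sInf {m | ∃ T : Matrix (Fin n) (Fin n) K, IsUnit T.det ∧
    ∀ a b : AlgebraicClosure K,
      DependsOnlyOnFirst m
        (MvPolynomial.C a * MvPolynomial.map (algebraMap K (AlgebraicClosure K)) (substMat T q₁) +
         MvPolynomial.C b * MvPolynomial.map (algebraMap K (AlgebraicClosure K)) (substMat T q₂))}

/-- The symmetrized coefficient matrix `M(q)` of a quadratic form `q = ∑_{i ≤ j} q_{ij}X_iX_j`: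
its `(i,j)` entry is `q_{ij}` for `i < j`, `2q_{ii}` for `i = j`, and `q_{ji}` for `i > j`. -/
noncomputable def Mmat {K : Type*} [CommRing K] {n : ℕ}
    (q : MvPolynomial (Fin n) K) : Matrix (Fin n) (Fin n) K :=
  Matrix.of fun i j =>
    if i < j then q.coeff (Finsupp.single i 1 + Finsupp.single j 1)
    else if i = j then 2 * q.coeff (Finsupp.single i 2)
    else q.coeff (Finsupp.single j 1 + Finsupp.single i 1)

section QuadraticMatrix

variable {ι κ R S K : Type*} [Fintype ι] [Fintype κ] [CommRing R] [CommRing S] [Field K]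

/-- The value at `x` of the quadratic form with (not necessarily symmetric) matrix `A`. -/
def qval (A : Matrix ι ι R) (x : ι → R) : R := x ⬝ᵥ A.mulVec x

/-- The polar bilinear form of the quadratic form with matrix `A`. -/
def qpolar (A : Matrix ι ι R) (x y : ι → R) : R := x ⬝ᵥ (A + A.transpose).mulVec y

theorem qpolar_comm (A : Matrix ι ι R) (x y : ι → R) : qpolar A x y = qpolar A y x := by
  unfold qpolar
  rw [dotProduct_comm, ← Matrix.vecMul_transpose, ← Matrix.dotProduct_mulVec]
  simp [add_comm]

theorem qpolar_add_right (A : Matrix ι ι R) (x y z : ι → R) :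
    qpolar A x (y + z) = qpolar A x y + qpolar A x z := by
  simp [qpolar, Matrix.mulVec_add]

theorem qpolar_smul_right (A : Matrix ι ι R) (c : R) (x y : ι → R) :
    qpolar A x (c • y) = c * qpolar A x y := by
  simp [qpolar, Matrix.mulVec_smul]

theorem qpolar_add_left (A : Matrix ι ι R) (x y z : ι → R) :
    qpolar A (x + y) z = qpolar A x z + qpolar A y z := by
  simp [qpolar]

theorem qpolar_smul_left (A : Matrix ι ι R) (c : R) (x y : ι → R) :
    qpolar A (c • x) y = c * qpolar A x y := by
  simp [qpolar]

theorem qpolar_sum_right {α : Type*} (A : Matrix ι ι R) (s : Finset α) (x : ι → R)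
    (y : α → ι → R) : qpolar A x (∑ i ∈ s, y i) = ∑ i ∈ s, qpolar A x (y i) := by
  simp only [qpolar, Matrix.mulVec_sum, dotProduct_sum]

theorem qval_add (A : Matrix ι ι R) (x y : ι → R) :
    qval A (x + y) = qval A x + qval A y + qpolar A x y := by
  have h : x ⬝ᵥ A.transpose.mulVec y = y ⬝ᵥ A.mulVec x := by
    rw [dotProduct_comm, Matrix.mulVec_transpose, ← Matrix.dotProduct_mulVec]
  simp only [qval, qpolar, Matrix.mulVec_add, Matrix.add_mulVec, add_dotProduct, dotProduct_add, h]
  ring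

theorem qval_smul (A : Matrix ι ι R) (c : R) (x : ι → R) : qval A (c • x) = c ^ 2 * qval A x := by
  simp [qval, Matrix.mulVec_smul]
  ring

@[simp]
theorem qval_zero (A : Matrix ι ι R) : qval A 0 = 0 := by simp [qval]

theorem qpolar_self (A : Matrix ι ι R) (x : ι → R) : qpolar A x x = 2 * qval A x := by
  have h := qval_add A x x
  rw [← two_smul R x, qval_smul] at h
  linear_combination -h

theorem qval_transpose_mul_mul (A : Matrix ι ι R) (E : Matrix ι κ R) (x : κ → R) :
    qval (E.transpose * A * E) x = qval A (E.mulVec x) := by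
  simp only [qval, ← Matrix.mulVec_mulVec, Matrix.dotProduct_mulVec, Matrix.vecMul_transpose]

theorem qpolar_transpose_mul_mul (A : Matrix ι ι R) (E : Matrix ι κ R) (x y : κ → R) :
    qpolar (E.transpose * A * E) x y = qpolar A (E.mulVec x) (E.mulVec y) := by
  have h1 := qval_add (E.transpose * A * E) x y
  have h2 := qval_add A (E.mulVec x) (E.mulVec y)
  rw [← Matrix.mulVec_add] at h2
  simp only [qval_transpose_mul_mul] at h1
  linear_combination h2 - h1

theorem map_qval (f : R →+* S) (A : Matrix ι ι R) (x : ι → R) :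
    f (qval A x) = qval (A.map f) (f ∘ x) := by
  have h : f ∘ A.mulVec x = (A.map f).mulVec (f ∘ x) := funext fun i => RingHom.map_mulVec f A x i
  rw [qval, RingHom.map_dotProduct, h, qval]

theorem forall_qpolar_eq_zero_iff (A : Matrix ι ι R) (x : ι → R) :
    (∀ y, qpolar A y x = 0) ↔ (A + A.transpose).mulVec x = 0 :=
  ⟨fun h => dotProduct_eq_zero_iff.1 fun w => (dotProduct_comm _ _).trans (h w),
    fun h y => by rw [qpolar, h, dotProduct_zero]⟩

/-- The radical of the polar form. -/
def polarKer (A : Matrix ι ι R) : Submodule R (ι → R) where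
  carrier := {x | ∀ y, qpolar A y x = 0}
  zero_mem' y := by simp [qpolar]
  add_mem' hx hy z := by rw [qpolar_add_right, hx, hy, add_zero]
  smul_mem' c x hx y := by rw [qpolar_smul_right, hx, mul_zero]

/-- The radical of the quadratic form with matrix `A`: the space of translations leaving the form
invariant. -/
def radical (A : Matrix ι ι R) : Submodule R (ι → R) where
  carrier := {x | (∀ y, qpolar A y x = 0) ∧ qval A x = 0}
  zero_mem' := ⟨fun y => by simp [qpolar], by simp⟩
  add_mem' {x y} hx hy :=
    ⟨(polarKer A).add_mem hx.1 hy.1, by rw [qval_add, hx.2, hy.2, hy.1]; simp⟩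
  smul_mem' c x hx := ⟨(polarKer A).smul_mem c hx.1, by rw [qval_smul, hx.2, mul_zero]⟩

theorem mem_polarKer {A : Matrix ι ι R} {x : ι → R} :
    x ∈ polarKer A ↔ ∀ y, qpolar A y x = 0 := Iff.rfl

theorem mem_radical {A : Matrix ι ι R} {x : ι → R} :
    x ∈ radical A ↔ (∀ y, qpolar A y x = 0) ∧ qval A x = 0 := Iff.rfl

theorem radical_le_polarKer (A : Matrix ι ι R) : radical A ≤ polarKer A := fun _ h => h.1

theorem mem_radical_iff_qval {A : Matrix ι ι R} {x : ι → R} :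
    x ∈ radical A ↔ ∀ y, qval A (y + x) = qval A y := by
  constructor
  · intro h y
    rw [qval_add, h.1, h.2]
    simp
  · intro h
    have h0 : qval A x = 0 := by simpa using h 0
    refine ⟨fun y => ?_, h0⟩
    have := h y
    rw [qval_add, h0] at this
    linear_combination this

theorem radical_congr {A A' : Matrix ι ι R} (h : ∀ x, qval A x = qval A' x) :
    radical A = radical A' := by
  ext x
  simp only [mem_radical_iff_qval, h]

theorem qval_add_matrix (A A' : Matrix ι ι R) (x : ι → R) :
    qval (A + A') x = qval A x + qval A' x := by
  simp [qval, Matrix.add_mulVec]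

theorem qval_smul_matrix (c : R) (A : Matrix ι ι R) (x : ι → R) :
    qval (c • A) x = c * qval A x := by
  simp [qval, Matrix.smul_mulVec]

theorem qpolar_add_matrix (A A' : Matrix ι ι R) (x y : ι → R) :
    qpolar (A + A') x y = qpolar A x y + qpolar A' x y := by
  simp [qpolar, Matrix.add_mulVec]
  ring

theorem qpolar_smul_matrix (c : R) (A : Matrix ι ι R) (x y : ι → R) :
    qpolar (c • A) x y = c * qpolar A x y := by
  simp [qpolar, Matrix.add_mulVec, Matrix.smul_mulVec]
  ring

theorem qval_vecMulVec (f g x : ι → R) :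
    qval (Matrix.vecMulVec f g) x = (f ⬝ᵥ x) * (g ⬝ᵥ x) := by
  simp [qval, Matrix.vecMulVec_mulVec, dotProduct_comm]
  ring

theorem qpolar_vecMulVec (f g x y : ι → R) :
    qpolar (Matrix.vecMulVec f g) x y = (f ⬝ᵥ x) * (g ⬝ᵥ y) + (f ⬝ᵥ y) * (g ⬝ᵥ x) := by
  have h := qval_add (Matrix.vecMulVec f g) x y
  simp only [qval_vecMulVec, dotProduct_add] at h
  linear_combination -h

theorem finrank_radical_congr [DecidableEq ι] (A : Matrix ι ι K) (T : Matrix ι ι K)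
    (hT : IsUnit T.det) :
    Module.finrank K (radical (T.transpose * A * T)) = Module.finrank K (radical A) := by
  let e : (ι → K) ≃ₗ[K] (ι → K) := Matrix.toLin'OfInv (M := T⁻¹) (M' := T)
    (Matrix.nonsing_inv_mul T hT) (Matrix.mul_nonsing_inv T hT)
  have he : ∀ x, e x = T.mulVec x := fun x => by simp [e, Matrix.toLin'OfInv]
  have : radical (T.transpose * A * T) = (radical A).comap e.toLinearMap := by
    ext x
    simp only [Submodule.mem_comap, LinearEquiv.coe_coe, he, mem_radical_iff_qval,
      qval_transpose_mul_mul, Matrix.mulVec_add]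
    refine ⟨fun h y => ?_, fun h y => h _⟩
    obtain ⟨z, rfl⟩ := e.surjective y
    rw [he]
    exact h z
  rw [this, Submodule.comap_equiv_eq_map_symm]
  exact LinearEquiv.finrank_map_eq _ _

theorem finrank_polarKer_le (hK : (2 : K) = 0 → ∀ a : K, ∃ b, b ^ 2 = a) (A : Matrix ι ι K) :
    Module.finrank K (polarKer A) ≤ Module.finrank K (radical A) + 1 := by
  by_cases hle : polarKer A ≤ radical A
  · exact (Submodule.finrank_mono hle).trans (Nat.le_succ _)
  obtain ⟨e, he, he'⟩ := Set.not_subset.1 hle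
  have hqe : qval A e ≠ 0 := fun h => he' ⟨he, h⟩
  have h2 : (2 : K) = 0 := by
    have := qpolar_self A e
    rw [he e] at this
    exact (mul_eq_zero.1 this.symm).resolve_right hqe
  have hle : polarKer A ≤ radical A ⊔ K ∙ e := by
    intro x hx
    obtain ⟨c, hc⟩ := hK h2 (qval A x / qval A e)
    have : x + c • e ∈ radical A := by
      refine ⟨(polarKer A).add_mem hx ((polarKer A).smul_mem c he), ?_⟩
      rw [qval_add, qpolar_smul_right, he, qval_smul, hc, div_mul_cancel₀ _ hqe]
      linear_combination h2 * qval A x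
    rw [Submodule.mem_sup]
    exact ⟨_, this, -c • e, Submodule.mem_span_singleton.2 ⟨-c, rfl⟩, by simp⟩
  calc _ ≤ _ := Submodule.finrank_mono hle
    _ ≤ _ := Submodule.finrank_add_le_finrank_add_finrank _ _
    _ ≤ _ := by gcongr; exact (finrank_span_le_card {e}).trans (by simp)

theorem two_eq_zero_of_polarKer_ne {A : Matrix ι ι K} (h : polarKer A ≠ radical A) :
    (2 : K) = 0 := by
  obtain ⟨e, he, he'⟩ := Set.not_subset.1 fun hle => h (le_antisymm hle (radical_le_polarKer A))
  have := qpolar_self A e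
  rw [he e] at this
  exact (mul_eq_zero.1 this.symm).resolve_right fun h => he' ⟨he, h⟩

variable [DecidableEq ι]

/-- A determinantal certificate of the triviality of the radical. -/
def NondegCert (A : Matrix ι ι R) (v : ι → R) : Prop :=
  (A + A.transpose + Matrix.vecMulVec v v).det ≠ 0 ∧
    (v = 0 ∨ qval A ((A + A.transpose + Matrix.vecMulVec v v).adjugate.mulVec v) ≠ 0)

theorem radical_eq_bot_of_nondegCert {A : Matrix ι ι K} {v : ι → K} (h : NondegCert A v) :
    radical A = ⊥ := by
  obtain ⟨hdet, hv⟩ := h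
  rw [eq_bot_iff]
  rintro y ⟨hy, hqy⟩
  rw [forall_qpolar_eq_zero_iff] at hy
  set N := A + A.transpose + Matrix.vecMulVec v v with hN
  have hNy : N.mulVec y = (v ⬝ᵥ y) • v := by
    rw [hN, Matrix.add_mulVec, hy, zero_add, Matrix.vecMulVec_mulVec]
    ext; simp [mul_comm]
  have key : N.det • y = (v ⬝ᵥ y) • N.adjugate.mulVec v := by
    rw [← Matrix.mulVec_smul, ← hNy, Matrix.mulVec_mulVec, Matrix.adjugate_mul, Matrix.smul_mulVec,
      Matrix.one_mulVec]
  have hvy : (v ⬝ᵥ y) = 0 := by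
    rcases hv with rfl | hv
    · simp
    · have := congrArg (qval A) key
      rw [qval_smul, hqy, mul_zero, qval_smul] at this
      simpa [hv] using this.symm
  rw [hvy, zero_smul] at key
  exact (smul_eq_zero.1 key).resolve_left hdet

theorem exists_nondegCert (hK : (2 : K) = 0 → ∀ a : K, ∃ b, b ^ 2 = a) {A : Matrix ι ι K}
    (h : radical A = ⊥) : ∃ v, NondegCert A v := by
  have hfin := finrank_polarKer_le hK A
  rw [h, finrank_bot, zero_add] at hfin
  by_cases hker : polarKer A = ⊥
  · refine ⟨0, ?_, Or.inl rfl⟩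
    simp only [Matrix.vecMulVec_zero, add_zero]
    intro hdet
    obtain ⟨x, hx, hx0⟩ := Matrix.exists_mulVec_eq_zero_iff.2 hdet
    rw [← forall_qpolar_eq_zero_iff, ← mem_polarKer, hker] at hx0
    exact hx hx0
  obtain ⟨e, he, he0⟩ := Submodule.exists_mem_ne_zero_of_ne_bot hker
  have hspan : ∀ y ∈ polarKer A, ∃ c : K, y = c • e := by
    intro y hy
    obtain ⟨c, hc⟩ := (finrank_eq_one_iff_of_nonzero' (⟨e, he⟩ : polarKer A)
      (by simpa using he0)).1 (le_antisymm hfin (Submodule.one_le_finrank_iff.2 hker)) ⟨y, hy⟩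
    exact ⟨c, (congrArg Subtype.val hc).symm⟩
  have hqe : qval A e ≠ 0 := fun hq => he0 (by
    have : e ∈ radical A := ⟨he, hq⟩
    simpa [h] using this)
  obtain ⟨v, hv⟩ : ∃ v : ι → K, v ⬝ᵥ e ≠ 0 := by
    by_contra! hall
    exact he0 (dotProduct_eq_zero_iff.1 fun w => (dotProduct_comm _ _).trans (hall w))
  have heB := (forall_qpolar_eq_zero_iff A e).1 he
  have hdet : (A + A.transpose + Matrix.vecMulVec v v).det ≠ 0 := by
    intro hdet
    obtain ⟨y, hy0, hy⟩ := Matrix.exists_mulVec_eq_zero_iff.2 hdet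
    rw [Matrix.add_mulVec] at hy
    have h1 := congrArg (e ⬝ᵥ ·) hy
    simp only [dotProduct_add, dotProduct_zero] at h1
    have h2 : e ⬝ᵥ (A + A.transpose).mulVec y = 0 := (qpolar_comm A e y).trans (he y)
    rw [h2, zero_add, Matrix.vecMulVec_mulVec] at h1
    have hvy : v ⬝ᵥ y = 0 := by
      rw [dotProduct_comm] at hv
      simpa [hv] using h1
    rw [Matrix.vecMulVec_mulVec, hvy] at hy
    simp only [MulOpposite.op_zero, zero_smul, add_zero] at hy
    obtain ⟨c, rfl⟩ := hspan y ((forall_qpolar_eq_zero_iff A y).2 hy)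
    rw [dotProduct_smul, smul_eq_mul, mul_eq_zero] at hvy
    rcases hvy with rfl | h0
    · exact hy0 (zero_smul _ _)
    · exact hv h0
  refine ⟨v, hdet, Or.inr fun hq => ?_⟩
  set N := A + A.transpose + Matrix.vecMulVec v v with hN
  have hNy : N.mulVec e = (v ⬝ᵥ e) • v := by
    rw [hN, Matrix.add_mulVec, heB, zero_add, Matrix.vecMulVec_mulVec]
    ext; simp [mul_comm]
  have key : N.det • e = (v ⬝ᵥ e) • N.adjugate.mulVec v := by
    rw [← Matrix.mulVec_smul, ← hNy, Matrix.mulVec_mulVec, Matrix.adjugate_mul, Matrix.smul_mulVec,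
      Matrix.one_mulVec]
  have := congrArg (qval A) key
  rw [qval_smul, qval_smul, hq, mul_zero] at this
  simp [hdet, hqe] at this

end QuadraticMatrix

section Specialization

variable {ι κ K L : Type*} [Fintype ι] [Fintype κ] [DecidableEq κ] [Field K] [Field L]

theorem finrank_radical_add_card_le (A : Matrix ι ι K) (E : Matrix ι κ K) (v : κ → K)
    (h : NondegCert (E.transpose * A * E) v) :
    Module.finrank K (radical A) + Fintype.card κ ≤ Fintype.card ι := by
  have hbot := radical_eq_bot_of_nondegCert h
  have hE : ∀ y, E.mulVec y ∈ radical A → y = 0 := by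
    intro y hy
    have : y ∈ radical (E.transpose * A * E) :=
      ⟨fun z => by rw [qpolar_transpose_mul_mul, hy.1], by rw [qval_transpose_mul_mul, hy.2]⟩
    simpa [hbot] using this
  have hinj : Function.Injective ((radical A).subtype.coprod E.mulVecLin) := by
    rw [injective_iff_map_eq_zero]
    rintro ⟨⟨x, hx⟩, y⟩ hxy
    simp only [LinearMap.coprod_apply, Submodule.subtype_apply, Matrix.mulVecLin_apply] at hxy
    have hy : y = 0 := hE y (by
      rw [← neg_eq_iff_add_eq_zero.2 hxy]
      exact neg_mem hx)
    subst hy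
    simpa using hxy
  have := LinearMap.finrank_le_finrank_of_injective hinj
  simpa using this

theorem exists_compression_nondegCert (hK : (2 : K) = 0 → ∀ a : K, ∃ b, b ^ 2 = a)
    (A : Matrix ι ι K) :
    ∃ (m : ℕ) (E : Matrix ι (Fin m) K) (v : Fin m → K),
      m + Module.finrank K (radical A) = Fintype.card ι ∧
      NondegCert (E.transpose * A * E) v := by
  obtain ⟨U, hU⟩ := Submodule.exists_isCompl (radical A)
  let b := Module.finBasis K U
  let E : Matrix ι (Fin (Module.finrank K U)) K := Matrix.of fun i j => (b j : ι → K) i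
  have hEmul (y : Fin (Module.finrank K U) → K) : E.mulVec y = (∑ j, y j • b j : U) := by
    ext i
    simp [E, Matrix.mulVec, dotProduct, mul_comm]
  have hrad : radical (E.transpose * A * E) = ⊥ := by
    rw [eq_bot_iff]
    rintro y ⟨hy, hqy⟩
    rw [qval_transpose_mul_mul] at hqy
    have hmem : E.mulVec y ∈ radical A := by
      refine ⟨fun z => ?_, hqy⟩
      obtain ⟨u, hu, s, hs, rfl⟩ :=
        Submodule.mem_sup.1 (hU.sup_eq_top ▸ Submodule.mem_top : z ∈ radical A ⊔ U)
      have h2 := hy (b.repr ⟨s, hs⟩)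
      rw [qpolar_transpose_mul_mul, hEmul (b.repr ⟨s, hs⟩), b.sum_repr] at h2
      rw [qpolar_add_left, h2, qpolar_comm, hu.1, add_zero]
    have hzero : E.mulVec y = 0 := by
      have := hU.disjoint.le_bot ⟨hmem, by rw [hEmul]; exact Subtype.property _⟩
      simpa using this
    rw [hEmul, Submodule.coe_eq_zero] at hzero
    exact funext (Fintype.linearIndependent_iff.1 b.linearIndependent y hzero)
  obtain ⟨v, hv⟩ := exists_nondegCert hK hrad
  refine ⟨_, E, v, ?_, hv⟩
  rw [add_comm, Submodule.finrank_add_eq_of_isCompl hU, Module.finrank_fintype_fun_eq_card]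

theorem map_gram_det {R S : Type*} [CommRing R] [CommRing S] (f : R →+* S) (A : Matrix κ κ R)
    (v : κ → R) :
    f (A + A.transpose + Matrix.vecMulVec v v).det =
      (A.map f + (A.map f).transpose + Matrix.vecMulVec (f ∘ v) (f ∘ v)).det := by
  rw [RingHom.map_det]
  congr 1
  ext i j
  simp [Matrix.vecMulVec_apply]

theorem map_gram_qval {R S : Type*} [CommRing R] [CommRing S] (f : R →+* S) (A : Matrix κ κ R)
    (v : κ → R) :
    f (qval A ((A + A.transpose + Matrix.vecMulVec v v).adjugate.mulVec v)) =
      qval (A.map f) ((A.map f + (A.map f).transpose +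
        Matrix.vecMulVec (f ∘ v) (f ∘ v)).adjugate.mulVec (f ∘ v)) := by
  rw [map_qval]
  congr 1
  have h : (A.map f + (A.map f).transpose + Matrix.vecMulVec (f ∘ v) (f ∘ v)).adjugate =
      (A + A.transpose + Matrix.vecMulVec v v).adjugate.map f := by
    have := RingHom.map_adjugate f (A + A.transpose + Matrix.vecMulVec v v)
    simp only [RingHom.mapMatrix_apply] at this
    rw [this]
    congr 1
    ext i j
    simp [Matrix.vecMulVec_apply]
  rw [h]
  exact funext fun i => RingHom.map_mulVec f _ v i

theorem NondegCert.map (f : K →+* L) {A : Matrix κ κ K} {v : κ → K} (h : NondegCert A v) :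
    NondegCert (A.map f) (f ∘ v) := by
  refine ⟨?_, h.2.imp ?_ fun h => ?_⟩
  · rw [← map_gram_det, map_ne_zero]
    exact h.1
  · rintro rfl
    ext
    simp
  · rw [← map_gram_qval, map_ne_zero]
    exact h

/-- The dimension of the radical does not increase under extension of scalars. -/
theorem finrank_radical_map_le (hK : (2 : K) = 0 → ∀ a : K, ∃ b, b ^ 2 = a) (f : K →+* L)
    (A : Matrix ι ι K) :
    Module.finrank L (radical (A.map f)) ≤ Module.finrank K (radical A) := by
  obtain ⟨m, E, v, hm, hc⟩ := exists_compression_nondegCert hK A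
  have h := hc.map f
  rw [Matrix.map_mul, Matrix.map_mul, Matrix.transpose_map] at h
  have := finrank_radical_add_card_le _ _ _ h
  rw [Fintype.card_fin] at this
  omega

open Polynomial in
/-- In a polynomial family, the dimension of the radical can only jump up at special values. -/
theorem le_finrank_radical_eval_zero [Infinite K]
    (hK : (2 : K) = 0 → ∀ a : K, ∃ b, b ^ 2 = a) (A : Matrix ι ι K[X]) (d : ℕ)
    (h : ∀ t : K, t ≠ 0 → d ≤ Module.finrank K (radical (A.map (evalRingHom t)))) :
    d ≤ Module.finrank K (radical (A.map (evalRingHom (0 : K)))) := by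
  obtain ⟨m, E, v, hm, hdet, hq⟩ := exists_compression_nondegCert hK (A.map (evalRingHom (0 : K)))
  let E' : Matrix ι (Fin m) K[X] := E.map Polynomial.C
  let A' := E'.transpose * A * E'
  have hE (t : K) : E'.map (evalRingHom t) = E := by ext; simp [E']
  have hA' (t : K) : A'.map (evalRingHom t) = E.transpose * A.map (evalRingHom t) * E := by
    rw [Matrix.map_mul, Matrix.map_mul, Matrix.transpose_map, hE]
  let v' : Fin m → K[X] := Polynomial.C ∘ v
  have hv (t : K) : evalRingHom t ∘ v' = v := by ext; simp [v']
  let P := (A' + A'.transpose + Matrix.vecMulVec v' v').det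
  let Q := qval A' ((A' + A'.transpose + Matrix.vecMulVec v' v').adjugate.mulVec v')
  have hP (t : K) := map_gram_det (evalRingHom t) A' v'
  have hQ (t : K) := map_gram_qval (evalRingHom t) A' v'
  simp only [hA', hv] at hP hQ
  have hP0 : P ≠ 0 := by
    rintro hP0
    rw [← hP 0] at hdet
    exact hdet (by
      change evalRingHom 0 P = 0
      rw [hP0, map_zero])
  obtain ⟨t, ht0, htP, htQ⟩ : ∃ t : K, t ≠ 0 ∧ P.eval t ≠ 0 ∧ (v = 0 ∨ Q.eval t ≠ 0) := by
    by_cases hv0 : v = 0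
    · have hne : P * Polynomial.X ≠ 0 := mul_ne_zero hP0 Polynomial.X_ne_zero
      obtain ⟨t, ht⟩ := Polynomial.exists_eval_ne_zero_of_natDegree_lt_card _ hne
        ((Cardinal.natCast_lt_aleph0).trans_le (Cardinal.aleph0_le_mk K))
      simp only [Polynomial.eval_mul, Polynomial.eval_X, mul_ne_zero_iff] at ht
      exact ⟨t, ht.2, ht.1, Or.inl hv0⟩
    · have hQ0 : Q ≠ 0 := by
        rintro hQ0
        have hq' := hq.resolve_left hv0
        rw [← hQ 0] at hq'
        exact hq' (by
          change evalRingHom 0 Q = 0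
          rw [hQ0, map_zero])
      have hne : P * Q * Polynomial.X ≠ 0 :=
        mul_ne_zero (mul_ne_zero hP0 hQ0) Polynomial.X_ne_zero
      obtain ⟨t, ht⟩ := Polynomial.exists_eval_ne_zero_of_natDegree_lt_card _ hne
        ((Cardinal.natCast_lt_aleph0).trans_le (Cardinal.aleph0_le_mk K))
      simp only [Polynomial.eval_mul, Polynomial.eval_X, mul_ne_zero_iff] at ht
      exact ⟨t, ht.2, ht.1.1, Or.inr ht.1.2⟩
  have hcert : NondegCert (E.transpose * A.map (evalRingHom t) * E) v := by
    refine ⟨?_, htQ.imp_right fun htQ => ?_⟩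
    · rw [← hP t]
      exact htP
    · rw [← hQ t]
      exact htQ
  have h1 := finrank_radical_add_card_le _ _ _ hcert
  rw [Fintype.card_fin] at h1
  have h2 := h t ht0
  omega

end Specialization

section Parity

variable {ι K : Type*} [Fintype ι] [DecidableEq ι] [Field K]

theorem det_eq_zero_of_odd_card {R : Type*} [CommRing R] (h2 : (2 : R) = 0) (B : Matrix ι ι R)
    (hsymm : B.transpose = B) (hdiag : ∀ i, B i i = 0) (hodd : Odd (Fintype.card ι)) :
    B.det = 0 := by
  have hadd (x : R) : x + x = 0 := by linear_combination x * h2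
  have hneg : (-1 : R) = 1 := by linear_combination -h2
  have hinv (σ : Equiv.Perm ι) : ∏ i, B (σ⁻¹ i) i = ∏ i, B (σ i) i := by
    rw [← Equiv.prod_comp σ]
    refine Finset.prod_congr rfl fun i _ => ?_
    rw [show σ⁻¹ (σ i) = i by simp, ← Matrix.transpose_apply B, hsymm]
  have hsign (σ : Equiv.Perm ι) : ((σ.sign : ℤ) : R) = 1 := by
    rcases Int.units_eq_one_or σ.sign with h | h <;> simp [h, hneg]
  rw [Matrix.det_apply']
  refine Finset.sum_involution (fun σ _ => σ⁻¹) (fun σ _ => ?_) (fun σ _ hne heq => ?_)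
    (fun σ _ => Finset.mem_univ _) (fun σ _ => inv_inv σ)
  · simp only [hsign, hinv, one_mul, hadd]
  · obtain ⟨i, hi⟩ := Equiv.Perm.exists_fixed_point_of_prime (p := 2) (n := 1) (σ := σ)
      (by rwa [← even_iff_two_dvd, Nat.not_even_iff_odd])
      (by rw [pow_one, sq]; nth_rewrite 1 [← heq]; exact inv_mul_cancel σ)
    refine hne ?_
    rw [Finset.prod_eq_zero (Finset.mem_univ i) (by rw [hi, hdiag]), mul_zero]

/-- Adding `v vᵀ` does not change the determinant of an alternating matrix of even size in
characteristic two. -/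
theorem det_add_vecMulVec_of_even_card {R : Type*} [CommRing R] (h2 : (2 : R) = 0)
    (B : Matrix ι ι R) (v : ι → R) (hsymm : B.transpose = B) (hdiag : ∀ i, B i i = 0)
    (heven : Even (Fintype.card ι)) :
    (B + Matrix.vecMulVec v v).det = B.det := by
  have hneg (x : R) : -x = x := by linear_combination -x * h2
  let c : Matrix ι Unit R := Matrix.of fun i _ => v i
  have h1 : (B + Matrix.vecMulVec v v).det = (Matrix.fromBlocks B c c.transpose 1).det := by
    rw [Matrix.det_fromBlocks_one₂₂]
    congr 1
    ext i j
    simp [c, Matrix.mul_apply, Matrix.vecMulVec_apply, sub_eq_add_neg, hneg]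
  have h2' : Matrix.fromBlocks B c c.transpose 1 =
      (Matrix.fromBlocks B c c.transpose 0).updateRow (Sum.inr ())
        (Matrix.fromBlocks B c c.transpose 0 (Sum.inr ()) + Pi.single (Sum.inr ()) 1) := by
    ext (i | i) (j | j) <;> simp [Matrix.updateRow_apply]
  have h3 : (Matrix.fromBlocks B c c.transpose 0).updateRow (Sum.inr ())
        (Pi.single (Sum.inr ()) 1) = Matrix.fromBlocks B c 0 1 := by
    ext (i | i) (j | j) <;> simp [Matrix.updateRow_apply]
  rw [h1, h2', Matrix.det_updateRow_add, h3, Matrix.det_fromBlocks_zero₂₁, Matrix.updateRow_eq_self,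
    det_eq_zero_of_odd_card h2, Matrix.det_one, mul_one, zero_add]
  · rw [Matrix.fromBlocks_transpose, hsymm]
    simp
  · rintro (i | i) <;> simp [hdiag]
  · simpa using heven.add_one

omit [DecidableEq ι] in
theorem polarKer_eq_radical_of_even (hK : (2 : K) = 0 → ∀ a : K, ∃ b, b ^ 2 = a)
    (A : Matrix ι ι K) (h : Even (Fintype.card ι - Module.finrank K (radical A))) :
    polarKer A = radical A := by
  by_contra hne
  have h2 := two_eq_zero_of_polarKer_ne hne
  obtain ⟨m, E, v, hm, hdet, -⟩ := exists_compression_nondegCert hK A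
  set B := E.transpose * A * E with hB
  rw [det_add_vecMulVec_of_even_card h2] at hdet
  · have hE : ∀ y, E.mulVec y ∈ polarKer A → y = 0 := by
      intro y hy
      have : (B + B.transpose).mulVec y = 0 := by
        rw [← forall_qpolar_eq_zero_iff]
        intro z
        rw [hB, qpolar_transpose_mul_mul]
        exact hy _
      exact Matrix.eq_zero_of_mulVec_eq_zero hdet this
    have hinj : Function.Injective ((polarKer A).subtype.coprod E.mulVecLin) := by
      rw [injective_iff_map_eq_zero]
      rintro ⟨⟨x, hx⟩, y⟩ hxy
      simp only [LinearMap.coprod_apply, Submodule.subtype_apply, Matrix.mulVecLin_apply] at hxy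
      have hy : y = 0 := hE y (by
        rw [← neg_eq_iff_add_eq_zero.2 hxy]
        exact neg_mem hx)
      subst hy
      simpa using hxy
    have := LinearMap.finrank_le_finrank_of_injective hinj
    simp at this
    exact hne (Submodule.eq_of_le_of_finrank_le (radical_le_polarKer A) (by omega)).symm
  · rw [Matrix.transpose_add, Matrix.transpose_transpose, add_comm]
  · intro i
    rw [Matrix.add_apply, Matrix.transpose_apply]
    linear_combination B i i * h2
  · rw [Fintype.card_fin]
    convert h using 1
    omega

end Parity

section PolynomialOfMatrix

variable {ι R S K : Type*} [Fintype ι] [CommRing R] [CommRing S] [Field K] {n : ℕ}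

/-- The quadratic form with matrix `A`, as a polynomial. -/
noncomputable def polyOf (A : Matrix ι ι R) : MvPolynomial ι R :=
  qval (A.map MvPolynomial.C) MvPolynomial.X

theorem eval_polyOf (A : Matrix ι ι R) (x : ι → R) : MvPolynomial.eval x (polyOf A) = qval A x := by
  rw [polyOf, map_qval]
  congr 1
  · ext; simp
  · ext; simp

theorem map_polyOf (f : R →+* S) (A : Matrix ι ι R) :
    MvPolynomial.map f (polyOf A) = polyOf (A.map f) := by
  rw [polyOf, map_qval, polyOf]
  congr 1
  · ext; simp
  · ext; simp

theorem polyOf_add (A B : Matrix ι ι R) : polyOf (A + B) = polyOf A + polyOf B := by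
  simp only [polyOf, ← qval_add_matrix]
  congr 1
  ext; simp

theorem C_mul_polyOf (c : R) (A : Matrix ι ι R) :
    MvPolynomial.C c * polyOf A = polyOf (c • A) := by
  simp only [polyOf, ← qval_smul_matrix]
  congr 1
  ext; simp

theorem polyOf_zero : polyOf (0 : Matrix ι ι R) = 0 := by
  simp [polyOf, qval]

theorem polyOf_vecMulVec (f g : ι → R) :
    polyOf (Matrix.vecMulVec f g) =
      (∑ i, MvPolynomial.C (f i) * MvPolynomial.X i) *
        ∑ i, MvPolynomial.C (g i) * MvPolynomial.X i := by
  rw [polyOf, show (Matrix.vecMulVec f g).map MvPolynomial.C =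
    Matrix.vecMulVec (MvPolynomial.C (σ := ι) ∘ f) (MvPolynomial.C ∘ g) by
      ext; simp [Matrix.vecMulVec_apply], qval_vecMulVec]
  simp [dotProduct]

theorem polyOf_eq_sum (A : Matrix ι ι R) :
    polyOf A = ∑ i, ∑ j, MvPolynomial.C (A i j) * (MvPolynomial.X i * MvPolynomial.X j) := by
  simp only [polyOf, qval, dotProduct, Matrix.mulVec, Matrix.map_apply, Finset.mul_sum]
  exact Finset.sum_congr rfl fun i _ => Finset.sum_congr rfl fun j _ => by ring

theorem substMat_polyOf (T A : Matrix (Fin n) (Fin n) R) :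
    substMat T (polyOf A) = polyOf (T.transpose * A * T) := by
  have h : (T.map MvPolynomial.C).mulVec (MvPolynomial.X (R := R)) =
      fun i => ∑ j, MvPolynomial.C (T i j) * MvPolynomial.X j := by
    ext1 i
    simp [Matrix.mulVec, dotProduct]
  rw [polyOf, substMat, polyOf, Matrix.map_mul, Matrix.map_mul, Matrix.transpose_map,
    qval_transpose_mul_mul, h]
  refine (map_qval (MvPolynomial.aeval (R := R) fun i =>
    ∑ j, MvPolynomial.C (T i j) * MvPolynomial.X j : MvPolynomial (Fin n) R →ₐ[R] _).toRingHom
    _ _).trans ?_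
  congr 1
  · ext1 i j
    simp [MvPolynomial.algebraMap_eq]
  · ext1 i
    simp

theorem polyOf_eq_of_qval_eq {A B : Matrix ι ι K} (h : ∀ x, qval A x = qval B x) :
    polyOf A = polyOf B := by
  classical
  obtain ⟨D, rfl⟩ : ∃ D, A = D + B := ⟨A - B, by simp⟩
  have hD (x : ι → K) : qval D x = 0 := by
    have := h x
    rwa [qval_add_matrix, add_eq_right] at this
  have hpol (i j : ι) : D i j + D j i = 0 := by
    have := qval_add D (Pi.single i 1) (Pi.single j 1)
    rw [hD, hD, hD, zero_add, zero_add] at this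
    simpa [qpolar] using this.symm
  have hdiag (i : ι) : D i i = 0 := by simpa [qval] using hD (Pi.single i 1)
  rw [polyOf_add, add_eq_right, polyOf_eq_sum, ← Fintype.sum_prod_type']
  refine Finset.sum_involution (fun p _ => p.swap) (fun p _ => ?_) (fun p _ hne heq => ?_)
    (fun p _ => Finset.mem_univ _) (fun p _ => p.swap_swap)
  · rw [Prod.fst_swap, Prod.snd_swap, mul_comm (MvPolynomial.X p.2), ← add_mul, ← map_add, hpol,
      map_zero, zero_mul]
  · have : p.2 = p.1 := congrArg Prod.fst heq
    rw [this, hdiag, map_zero, zero_mul] at hne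
    exact hne rfl

theorem exists_polyOf_eq {q : MvPolynomial ι R} (hq : q.IsHomogeneous 2) :
    ∃ A : Matrix ι ι R, polyOf A = q := by
  classical
  rw [← q.support_sum_monomial_coeff]
  refine Finset.sum_induction _ (fun p => ∃ A : Matrix ι ι R, polyOf A = p) ?_ ⟨0, polyOf_zero⟩ ?_
  · rintro _ _ ⟨A, rfl⟩ ⟨B, rfl⟩
    exact ⟨A + B, polyOf_add A B⟩
  · intro d hd
    have hdeg : d.degree = 2 := by
      by_contra hne
      exact MvPolynomial.mem_support_iff.1 hd (hq.coeff_eq_zero hne)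
    obtain ⟨i, j, hij⟩ := Multiset.card_eq_two.1
      ((Finsupp.card_toMultiset d).trans hdeg)
    have hd' : d = Finsupp.single i 1 + Finsupp.single j 1 := by
      ext a
      rw [← Finsupp.count_toMultiset, hij]
      simp [Finsupp.single_apply, ← Multiset.singleton_add, Multiset.count_singleton, eq_comm]
    refine ⟨Matrix.single i j (q.coeff d), ?_⟩
    rw [polyOf_eq_sum, Finset.sum_eq_single i, Finset.sum_eq_single j]
    · rw [hd', Matrix.single_apply_same]
      simp [MvPolynomial.X, MvPolynomial.C_mul_monomial, MvPolynomial.monomial_mul]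
    · intro b _ hb
      simp [Matrix.single, hb.symm]
    · simp
    · intro b _ hb
      simp [Matrix.single, hb.symm]
    · simp

end PolynomialOfMatrix

section Rank

variable {K : Type*} [Field K] {n : ℕ}

theorem dependsOnlyOnFirst_iff {R : Type*} [CommRing R] {m : ℕ} {q : MvPolynomial (Fin n) R} :
    DependsOnlyOnFirst m q ↔ q ∈ MvPolynomial.supported R {i : Fin n | (i : ℕ) < m} := by
  rw [MvPolynomial.mem_supported]
  rfl

theorem dependsOnlyOnFirst_sum {m : ℕ} (f : Fin n → K)
    (h : ∀ i : Fin n, m ≤ i → f i = 0) :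
    DependsOnlyOnFirst m (∑ i, MvPolynomial.C (f i) * MvPolynomial.X i) := by
  rw [dependsOnlyOnFirst_iff]
  refine Subalgebra.sum_mem _ fun i _ => ?_
  by_cases hi : (i : ℕ) < m
  · exact mul_mem (Subalgebra.algebraMap_mem _ _) (MvPolynomial.X_mem_supported.2 hi)
  · rw [h i (not_lt.1 hi), map_zero, zero_mul]
    exact zero_mem _

theorem dependsOnlyOnFirst_polyOf_iff {m : ℕ} {A : Matrix (Fin n) (Fin n) K} :
    DependsOnlyOnFirst m (polyOf A) ↔ ∀ i : Fin n, m ≤ i → Pi.single i 1 ∈ radical A := by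
  constructor
  · intro h i hi
    rw [mem_radical_iff_qval]
    intro y
    rw [← eval_polyOf, ← eval_polyOf]
    refine MvPolynomial.eval₂Hom_congr' rfl (fun j hj _ => ?_) rfl
    have : j ≠ i := fun hji => by
      have := h j hj
      rw [hji] at this
      omega
    simp [this]
  · intro h
    let P : Matrix (Fin n) (Fin n) K := Matrix.diagonal fun i => if (i : ℕ) < m then 1 else 0
    have hP (x : Fin n → K) : x - P.mulVec x ∈ radical A := by
      have : x - P.mulVec x = ∑ i, (x - P.mulVec x) i • Pi.single i (1 : K) := by
        rw [← pi_eq_sum_univ']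
      rw [this]
      refine Submodule.sum_mem _ fun i _ => ?_
      by_cases hi : (i : ℕ) < m
      · simp [P, Matrix.mulVec_diagonal, hi]
      · exact Submodule.smul_mem _ _ (h i (not_lt.1 hi))
    have hq : polyOf A = polyOf (P.transpose * A * P) := by
      refine polyOf_eq_of_qval_eq fun x => ?_
      rw [qval_transpose_mul_mul]
      have := mem_radical_iff_qval.1 (hP x) (P.mulVec x)
      rwa [add_sub_cancel] at this
    rw [hq, polyOf_eq_sum, dependsOnlyOnFirst_iff]
    refine Subalgebra.sum_mem _ fun i _ => Subalgebra.sum_mem _ fun j _ => ?_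
    by_cases hi : (i : ℕ) < m
    · by_cases hj : (j : ℕ) < m
      · exact mul_mem (Subalgebra.algebraMap_mem _ _)
          (mul_mem (MvPolynomial.X_mem_supported.2 hi)
            (MvPolynomial.X_mem_supported.2 hj))
      · simp [P, Matrix.mul_diagonal, hj]
    · simp [P, Matrix.diagonal_transpose, Matrix.diagonal_mul, hi]

theorem exists_matrix_of_disjoint (D C : Submodule K (Fin n → K)) {k : ℕ} (u : Fin k → Fin n → K)
    (hu : LinearIndependent K u) (hDC : Disjoint D C)
    (huDC : Disjoint (Submodule.span K (Set.range u)) (D ⊔ C))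
    (hn : Module.finrank K D + k + Module.finrank K C = n) :
    ∃ T : Matrix (Fin n) (Fin n) K, IsUnit T.det ∧
      (∀ i : Fin n, (i : ℕ) < Module.finrank K D → T.col i ∈ D) ∧
      (∀ (i : Fin n) (j : Fin k), (i : ℕ) = Module.finrank K D + j → T.col i = u j) ∧
      ∀ i : Fin n, Module.finrank K D + k ≤ i → T.col i ∈ C := by
  let bD := Module.finBasis K D
  let bC := Module.finBasis K C
  have hbD : LinearIndependent K fun i => (bD i : Fin n → K) :=
    bD.linearIndependent.map' D.subtype D.ker_subtype
  have hbC : LinearIndependent K fun i => (bC i : Fin n → K) :=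
    bC.linearIndependent.map' C.subtype C.ker_subtype
  have hsD : Submodule.span K (Set.range fun i => (bD i : Fin n → K)) ≤ D :=
    Submodule.span_le.2 (by rintro _ ⟨i, rfl⟩; exact (bD i).2)
  have hsC : Submodule.span K (Set.range fun i => (bC i : Fin n → K)) ≤ C :=
    Submodule.span_le.2 (by rintro _ ⟨i, rfl⟩; exact (bC i).2)
  let w : (Fin (Module.finrank K D) ⊕ Fin k) ⊕ Fin (Module.finrank K C) → Fin n → K :=
    Sum.elim (Sum.elim (fun i => bD i) u) (fun i => bC i)
  have hw : LinearIndependent K w := by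
    refine (hbD.sum_type hu (huDC.symm.mono_left (hsD.trans le_sup_left))).sum_type hbC ?_
    rw [Set.Sum.elim_range, Submodule.span_union]
    rw [sup_comm]
    refine Disjoint.disjoint_sup_left_of_disjoint_sup_right ?_ ?_
    · exact hDC.mono hsD hsC
    · exact huDC.mono le_rfl (sup_le_sup hsD hsC)
  let e : (Fin (Module.finrank K D) ⊕ Fin k) ⊕ Fin (Module.finrank K C) ≃ Fin n :=
    ((Equiv.sumCongr finSumFinEquiv (Equiv.refl _)).trans finSumFinEquiv).trans (finCongr hn)
  let T : Matrix (Fin n) (Fin n) K := (Matrix.of (w ∘ e.symm)).transpose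
  have hT (s) : T.col (e s) = w s := by
    ext i
    simp [T, Matrix.col]
  refine ⟨T, ?_, fun i => ?_, fun i j => ?_, fun i => ?_⟩
  · rw [← Matrix.isUnit_iff_isUnit_det, ← Matrix.linearIndependent_cols_iff_isUnit]
    exact hw.comp _ e.symm.injective
  all_goals
    obtain ⟨((s | s) | s), rfl⟩ := e.surjective i
    all_goals
      rw [hT]
      simp only [e, w, Equiv.trans_apply, Equiv.sumCongr_apply, Sum.map_inl, Sum.map_inr,
        finSumFinEquiv_apply_left, finSumFinEquiv_apply_right, finCongr_apply, Fin.val_cast,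
        Fin.val_castAdd, Fin.val_natAdd, Equiv.refl_apply, Sum.elim_inl, Sum.elim_inr]
      intro h
      have := s.2
  any_goals omega
  · exact (bD s).2
  · congr 1
    ext
    omega
  · exact (bC s).2

theorem sInf_setOf_exists_matrix (C : Submodule K (Fin n → K)) :
    sInf {m : ℕ | ∃ T : Matrix (Fin n) (Fin n) K, IsUnit T.det ∧
      ∀ i : Fin n, m ≤ i → T.col i ∈ C} = n - Module.finrank K C := by
  apply le_antisymm
  · obtain ⟨D, hD⟩ := Submodule.exists_isCompl C
    have hn := Submodule.finrank_add_eq_of_isCompl hD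
    rw [Module.finrank_fin_fun] at hn
    obtain ⟨T, hT, -, -, hTC⟩ := exists_matrix_of_disjoint D C (k := 0) Fin.elim0
      (linearIndependent_empty_type) hD.disjoint.symm (by simp) (by omega)
    exact Nat.sInf_le ⟨T, hT, fun i hi => hTC i (by omega)⟩
  · refine le_csInf ⟨n, 1, by simp, fun i hi => absurd i.2 (by omega)⟩ ?_
    rintro m ⟨T, hT, hTC⟩
    by_contra! hlt
    have hli : LinearIndependent K T.col := by
      rwa [Matrix.linearIndependent_cols_iff_isUnit, Matrix.isUnit_iff_isUnit_det]
    let g : Fin (n - m) → C := fun i => ⟨T.col ⟨m + i, by omega⟩, hTC _ (by simp)⟩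
    have hg : LinearIndependent K g := by
      refine LinearIndependent.of_comp C.subtype ?_
      exact hli.comp (fun i : Fin (n - m) => (⟨m + i, by omega⟩ : Fin n))
        (fun i j h => by simpa [Fin.ext_iff] using h)
    have := hg.fintype_card_le_finrank
    rw [Fintype.card_fin] at this
    omega

theorem mem_radical_transpose_mul_mul {A T : Matrix (Fin n) (Fin n) K} (hT : IsUnit T.det)
    {x : Fin n → K} : x ∈ radical (T.transpose * A * T) ↔ T.mulVec x ∈ radical A := by
  simp only [mem_radical, qpolar_transpose_mul_mul, qval_transpose_mul_mul]
  refine and_congr_left fun _ => ⟨fun h y => ?_, fun h y => h _⟩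
  simpa [Matrix.mulVec_mulVec, Matrix.mul_nonsing_inv T hT] using h (T⁻¹.mulVec y)

theorem qRank_polyOf (A : Matrix (Fin n) (Fin n) K) :
    qRank (polyOf A) = n - Module.finrank K (radical A) := by
  rw [← sInf_setOf_exists_matrix, qRank]
  congr 1
  ext m
  refine exists_congr fun T => and_congr_right fun hT => ?_
  rw [substMat_polyOf, dependsOnlyOnFirst_polyOf_iff]
  simp only [mem_radical_transpose_mul_mul hT, Matrix.mulVec_single_one]

theorem dependsOnlyOnFirst_pencil_iff {L : Type*} [Field L] (f : K →+* L) {m : ℕ}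
    {p q : MvPolynomial (Fin n) K} :
    (∀ a b : L, DependsOnlyOnFirst m (MvPolynomial.C a * MvPolynomial.map f p +
      MvPolynomial.C b * MvPolynomial.map f q)) ↔
    DependsOnlyOnFirst m p ∧ DependsOnlyOnFirst m q := by
  have hmap (p : MvPolynomial (Fin n) K) :
      DependsOnlyOnFirst m (MvPolynomial.map f p) ↔ DependsOnlyOnFirst m p := by
    rw [DependsOnlyOnFirst, MvPolynomial.vars_map_of_injective _ f.injective]
    rfl
  constructor
  · intro h
    exact ⟨(hmap p).1 (by simpa using h 1 0), (hmap q).1 (by simpa using h 0 1)⟩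
  · rintro ⟨hp, hq⟩ a b
    rw [← hmap, dependsOnlyOnFirst_iff] at hp hq
    rw [dependsOnlyOnFirst_iff]
    exact add_mem (mul_mem (Subalgebra.algebraMap_mem _ _) hp)
      (mul_mem (Subalgebra.algebraMap_mem _ _) hq)

theorem pencilR_polyOf (A B : Matrix (Fin n) (Fin n) K) :
    pencilR (polyOf A) (polyOf B) =
      n - Module.finrank K (radical A ⊓ radical B : Submodule K (Fin n → K)) := by
  rw [← sInf_setOf_exists_matrix, pencilR]
  congr 1
  ext m
  refine exists_congr fun T => and_congr_right fun hT => ?_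
  rw [dependsOnlyOnFirst_pencil_iff, substMat_polyOf, substMat_polyOf,
    dependsOnlyOnFirst_polyOf_iff, dependsOnlyOnFirst_polyOf_iff, ← forall₂_and]
  simp only [mem_radical_transpose_mul_mul hT, Matrix.mulVec_single_one, Submodule.mem_inf]

theorem pencil_polyOf (A B : Matrix (Fin n) (Fin n) K) (a b : AlgebraicClosure K) :
    MvPolynomial.C a * MvPolynomial.map (algebraMap K (AlgebraicClosure K)) (polyOf A) +
      MvPolynomial.C b * MvPolynomial.map (algebraMap K (AlgebraicClosure K)) (polyOf B) =
    polyOf (a • A.map (algebraMap K (AlgebraicClosure K)) +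
      b • B.map (algebraMap K (AlgebraicClosure K))) := by
  rw [map_polyOf, map_polyOf, C_mul_polyOf, C_mul_polyOf, polyOf_add]

theorem le_pencilRmax_polyOf (A B : Matrix (Fin n) (Fin n) K) {a b : AlgebraicClosure K}
    (hab : a ≠ 0 ∨ b ≠ 0) :
    n - Module.finrank (AlgebraicClosure K)
      (radical (a • A.map (algebraMap K (AlgebraicClosure K)) +
        b • B.map (algebraMap K (AlgebraicClosure K)))) ≤ pencilRmax (polyOf A) (polyOf B) := by
  refine le_csSup ⟨n, ?_⟩ ⟨a, b, hab, ?_⟩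
  · rintro _ ⟨a, b, -, rfl⟩
    rw [pencil_polyOf, qRank_polyOf]
    exact Nat.sub_le _ _
  · rw [pencil_polyOf, qRank_polyOf]

theorem pencilRmax_polyOf_le (A B : Matrix (Fin n) (Fin n) K) {d : ℕ}
    (h : ∀ a b : AlgebraicClosure K, (a ≠ 0 ∨ b ≠ 0) →
      n - Module.finrank (AlgebraicClosure K)
        (radical (a • A.map (algebraMap K (AlgebraicClosure K)) +
          b • B.map (algebraMap K (AlgebraicClosure K)))) ≤ d) :
    pencilRmax (polyOf A) (polyOf B) ≤ d := by
  refine csSup_le ⟨_, 1, 0, Or.inl one_ne_zero, rfl⟩ ?_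
  rintro _ ⟨a, b, hab, rfl⟩
  rw [pencil_polyOf, qRank_polyOf]
  exact h a b hab

end Rank

section Perturbation

variable {ι K L : Type*} [Fintype ι] [DecidableEq ι] [Field K] [Field L]

omit [DecidableEq ι] in
theorem finrank_le_finrank_inf_ker_add_one (S : Submodule K (ι → K))
    (φ : Module.Dual K (ι → K)) :
    Module.finrank K S ≤ Module.finrank K (S ⊓ LinearMap.ker φ : Submodule K (ι → K)) + 1 := by
  have h1 := Submodule.finrank_sup_add_finrank_inf_eq S (LinearMap.ker φ)
  have h2 := LinearMap.finrank_range_add_finrank_ker φ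
  have h3 := (LinearMap.range φ).finrank_le
  have h4 := (S ⊔ LinearMap.ker φ).finrank_le
  rw [Module.finrank_self] at h3
  omega

omit [DecidableEq ι] in
theorem mem_radical_add_vecMulVec {A : Matrix ι ι K} {f g x : ι → K} (hx : x ∈ radical A)
    (hf : f ⬝ᵥ x = 0) (hg : g ⬝ᵥ x = 0) : x ∈ radical (A + Matrix.vecMulVec f g) := by
  refine ⟨fun y => ?_, ?_⟩
  · rw [qpolar_add_matrix, qpolar_vecMulVec, hx.1, hf, hg]
    ring
  · rw [qval_add_matrix, qval_vecMulVec, hx.2, hf]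
    ring

theorem finrank_radical_le_add_vecMulVec (A : Matrix ι ι K) (f g : ι → K) :
    Module.finrank K (radical A) ≤
      Module.finrank K (radical (A + Matrix.vecMulVec f g)) + 2 := by
  have h1 := finrank_le_finrank_inf_ker_add_one (radical A) (dotProductEquiv K ι f)
  have h2 := finrank_le_finrank_inf_ker_add_one
    (radical A ⊓ LinearMap.ker (dotProductEquiv K ι f)) (dotProductEquiv K ι g)
  have h3 : radical A ⊓ LinearMap.ker (dotProductEquiv K ι f) ⊓
      LinearMap.ker (dotProductEquiv K ι g) ≤ radical (A + Matrix.vecMulVec f g) :=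
    fun x hx => mem_radical_add_vecMulVec hx.1.1 hx.1.2 hx.2
  have := Submodule.finrank_mono h3
  omega

theorem finrank_radical_add_vecMulVec_add_two_le {A : Matrix ι ι K} {f g e₁ e₂ : ι → K}
    (h₁ : e₁ ∈ radical A) (h₂ : e₂ ∈ radical A) (hf₁ : f ⬝ᵥ e₁ ≠ 0) (hf₂ : f ⬝ᵥ e₂ = 0)
    (hg₂ : g ⬝ᵥ e₂ ≠ 0) :
    Module.finrank K (radical (A + Matrix.vecMulVec f g)) + 2 ≤ Module.finrank K (radical A) := by
  have key : ∀ x ∈ radical (A + Matrix.vecMulVec f g), x ∈ radical A ∧ f ⬝ᵥ x = 0 ∧ g ⬝ᵥ x = 0 := by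
    intro x hx
    have h (y : ι → K) : qpolar A y x + ((f ⬝ᵥ y) * (g ⬝ᵥ x) + (f ⬝ᵥ x) * (g ⬝ᵥ y)) = 0 := by
      rw [← qpolar_vecMulVec, ← qpolar_add_matrix]
      exact hx.1 y
    have hf : f ⬝ᵥ x = 0 := by
      have := h e₂
      rw [qpolar_comm, h₂.1, hf₂] at this
      simpa [hg₂] using this
    have hg : g ⬝ᵥ x = 0 := by
      have := h e₁
      rw [qpolar_comm, h₁.1, hf] at this
      simpa [hf₁] using this
    refine ⟨⟨fun y => by simpa [hf, hg] using h y, ?_⟩, hf, hg⟩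
    have := hx.2
    rwa [qval_add_matrix, qval_vecMulVec, hf, zero_mul, add_zero] at this
  have h1 : radical (A + Matrix.vecMulVec f g) <
      radical A ⊓ LinearMap.ker (dotProductEquiv K ι f) :=
    lt_of_le_of_ne (fun x hx => ⟨(key x hx).1, (key x hx).2.1⟩)
      fun h => hg₂ (key e₂ (h ▸ ⟨h₂, hf₂⟩)).2.2
  have h2 : radical A ⊓ LinearMap.ker (dotProductEquiv K ι f) < radical A :=
    lt_of_le_of_ne inf_le_left fun h => hf₁ (inf_eq_left.1 h h₁)
  have := Submodule.finrank_lt_finrank_of_lt h1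
  have := Submodule.finrank_lt_finrank_of_lt h2
  omega

omit [DecidableEq ι] in
theorem comp_mem_radical_map (f : K →+* L) {A : Matrix ι ι K} {x : ι → K} (hx : x ∈ radical A) :
    f ∘ x ∈ radical (A.map f) := by
  refine ⟨(forall_qpolar_eq_zero_iff _ _).2 ?_, by rw [← map_qval, hx.2, map_zero]⟩
  have h : A.map f + (A.map f).transpose = (A + A.transpose).map f := by
    ext; simp
  rw [h]
  ext i
  rw [← RingHom.map_mulVec, (forall_qpolar_eq_zero_iff _ _).1 hx.1]
  simp

omit [DecidableEq ι] in
theorem qval_map_eq (f : K →+* L) {A B : Matrix ι ι K} (h : ∀ x, qval A x = qval B x)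
    (x : ι → L) : qval (A.map f) x = qval (B.map f) x := by
  rw [← eval_polyOf, ← eval_polyOf, ← map_polyOf, ← map_polyOf, polyOf_eq_of_qval_eq h]

end Perturbation

section IsotropicVector

variable {K L : Type*} [Field K] [Field L] {n : ℕ}

theorem exists_projection_matrix (W : Submodule K (Fin n → K)) :
    ∃ P : Matrix (Fin n) (Fin n) K, (∀ x, P.mulVec x ∈ W) ∧ ∀ x ∈ W, P.mulVec x = x := by
  obtain ⟨g, hg⟩ := W.subtype.exists_leftInverse_of_injective W.ker_subtype
  refine ⟨LinearMap.toMatrix' (W.subtype ∘ₗ g), fun x => ?_, fun x hx => ?_⟩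
  · rw [LinearMap.toMatrix'_mulVec]
    exact (g x).2
  · rw [LinearMap.toMatrix'_mulVec]
    exact congrArg Subtype.val (LinearMap.congr_fun hg ⟨x, hx⟩)

open Polynomial in
theorem le_finrank_radical_add_compression [Infinite K]
    (hK : (2 : K) = 0 → ∀ a : K, ∃ b, b ^ 2 = a) {A B P : Matrix (Fin n) (Fin n) K} {d : ℕ}
    (hP : ∀ x, P.mulVec x ∈ radical A) (hPP : P * P = P)
    (h : ∀ a : K, d ≤ Module.finrank K (radical (a • A + B))) :
    d ≤ Module.finrank K (radical (A + P.transpose * B * P)) := by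
  let M : Matrix (Fin n) (Fin n) K[X] :=
    (Polynomial.X : K[X]) • (1 - P).map Polynomial.C + P.map Polynomial.C
  have hM (t : K) : M.map (evalRingHom t) = t • (1 - P) + P := by
    ext i j
    simp [M]
  have hfam (t : K) : (A.map Polynomial.C + M.transpose * B.map Polynomial.C * M).map
      (evalRingHom t) = A + (t • (1 - P) + P).transpose * B * (t • (1 - P) + P) := by
    rw [Matrix.map_add _ (map_add _), Matrix.map_mul, Matrix.map_mul, Matrix.transpose_map, hM]
    congr 1
    · ext; simp
    · congr 2
      ext; simp
  have := le_finrank_radical_eval_zero hK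
    (A.map Polynomial.C + M.transpose * B.map Polynomial.C * M) d fun t ht => ?_
  · rwa [hfam, zero_smul, zero_add] at this
  rw [hfam]
  set N := t • (1 - P) + P
  have hN : IsUnit N.det := by
    refine Matrix.isUnit_det_of_right_inverse (B := t⁻¹ • (1 - P) + P) ?_
    have h1 : (1 - P) * P = 0 := by rw [sub_mul, hPP, one_mul, sub_self]
    have h2 : P * (1 - P) = 0 := by rw [mul_sub, hPP, mul_one, sub_self]
    have h3 : (1 - P) * (1 - P) = 1 - P := by rw [mul_sub, h1, mul_one, sub_zero]
    simp only [N, add_mul, mul_add, smul_mul_assoc, mul_smul_comm, h1, h2, h3, hPP, smul_zero,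
      add_zero, zero_add, smul_smul, inv_mul_cancel₀ ht, one_smul]
    exact sub_add_cancel 1 P
  refine (h (t⁻¹ ^ 2)).trans_eq ?_
  rw [← finrank_radical_congr _ N hN]
  refine congrArg (fun S : Submodule K (Fin n → K) => Module.finrank K S)
    (radical_congr fun x => ?_)
  have hNx : N.mulVec x = t • x + (1 - t) • P.mulVec x := by
    simp only [N, Matrix.add_mulVec, Matrix.smul_mulVec, Matrix.sub_mulVec, Matrix.one_mulVec]
    module
  rw [qval_add_matrix, qval_transpose_mul_mul, qval_transpose_mul_mul, qval_add_matrix,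
    qval_smul_matrix]
  congr 1
  rw [hNx, mem_radical_iff_qval.1 (Submodule.smul_mem _ _ (hP x)), qval_smul]
  field_simp

/-- If all forms in a pencil have rank at most `r` and `A` has rank exactly `r`, then the quadric
defined by `B` cuts the radical of `A` in a large totally singular space. -/
theorem exists_isotropic_mem_radical [Infinite L] (f : K →+* L)
    (hK : (2 : K) = 0 → ∀ a : K, ∃ b, b ^ 2 = a) (hL : (2 : L) = 0 → ∀ a : L, ∃ b, b ^ 2 = a)
    {A B : Matrix (Fin n) (Fin n) K} {r R : ℕ} (hA : Module.finrank K (radical A) + r = n)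
    (hR : Module.finrank K (radical A ⊓ radical B : Submodule K (Fin n → K)) + R = n)
    (hrank : ∀ a : L, n ≤ Module.finrank L (radical (a • A.map f + B.map f)) + r)
    (hrR : r < R) (hcase : Even r ∨ r + 2 ≤ R) :
    ∃ w ∈ radical A, qval B w = 0 ∧ w ∉ radical B := by
  obtain ⟨P, hPA, hPid⟩ := exists_projection_matrix (radical A)
  set Q := A + P.transpose * B * P with hQ
  have hdim : Module.finrank K (radical A) ≤ Module.finrank K (radical Q) := by
    refine le_trans ?_ (finrank_radical_map_le hK f Q)
    have hmap : Q.map f = A.map f + (P.map f).transpose * B.map f * P.map f := by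
      rw [hQ, Matrix.map_add _ (map_add f), Matrix.map_mul, Matrix.map_mul, Matrix.transpose_map]
    rw [hmap]
    refine le_finrank_radical_add_compression hL (fun x => ?_) ?_ fun a => ?_
    · rw [Matrix.mulVec_eq_sum]
      refine Submodule.sum_mem _ fun i _ => ?_
      rw [op_smul_eq_smul]
      refine Submodule.smul_mem _ _ ?_
      have := comp_mem_radical_map f (hPA (Pi.single i 1))
      rw [Matrix.mulVec_single_one] at this
      exact this
    · rw [← Matrix.map_mul]
      congr 1
      refine Matrix.ext_of_mulVec_single fun i => ?_
      rw [← Matrix.mulVec_mulVec, hPid _ (hPA _)]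
    · have := hrank a
      omega
  have hsup : radical Q ⊔ radical A ≤ polarKer A := by
    refine sup_le (fun x hx y => ?_) (radical_le_polarKer A)
    have h1 := hx.1 (y - P.mulVec y)
    have h2 : P.mulVec (y - P.mulVec y) = 0 := by
      rw [Matrix.mulVec_sub, hPid _ (hPA y), sub_self]
    rw [hQ, qpolar_add_matrix, qpolar_transpose_mul_mul, h2] at h1
    have h3 : qpolar A y x = qpolar A (y - P.mulVec y) x + qpolar A (P.mulVec y) x := by
      rw [← qpolar_add_left, sub_add_cancel]
    rw [h3, qpolar_comm A (P.mulVec y), (hPA y).1]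
    simpa [qpolar] using h1
  have hker : Module.finrank K (polarKer A) + r < n + (R - r) := by
    have h1 := finrank_polarKer_le hK A
    rcases hcase with hr | hr
    · rw [polarKer_eq_radical_of_even hK A (by
        rw [Fintype.card_fin]
        convert hr using 1
        omega)]
      omega
    · omega
  have hinf := Submodule.finrank_sup_add_finrank_inf_eq (radical Q) (radical A)
  have hsup' := Submodule.finrank_mono hsup
  obtain ⟨w, hw, hwC⟩ : ∃ w ∈ radical Q ⊓ radical A, w ∉ radical A ⊓ radical B := by
    refine Set.not_subset.1 fun hle => ?_
    have := Submodule.finrank_mono (show radical Q ⊓ radical A ≤ radical A ⊓ radical B from hle)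
    omega
  refine ⟨w, hw.2, ?_, fun h => hwC ⟨hw.2, h⟩⟩
  have := hw.1.2
  rwa [hQ, qval_add_matrix, qval_transpose_mul_mul, hPid w hw.2, hw.2.2, zero_add] at this

end IsotropicVector

section NormalForm

variable {K : Type*} [Field K] {n : ℕ}

/-- The linear form `x ↦ qpolar A u x`. -/
def qpolarForm (A : Matrix (Fin n) (Fin n) K) (u : Fin n → K) : Module.Dual K (Fin n → K) where
  toFun := qpolar A u
  map_add' := qpolar_add_right A u
  map_smul' c := qpolar_smul_right A c u

theorem mem_ker_qpolarForm {A : Matrix (Fin n) (Fin n) K} {u x : Fin n → K} :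
    x ∈ LinearMap.ker (qpolarForm A u) ↔ qpolar A u x = 0 := Iff.rfl

theorem exists_hyperbolic_pair {B : Matrix (Fin n) (Fin n) K} {w : Fin n → K}
    (hw : qval B w = 0) (hwB : w ∉ radical B) : ∃ u, qval B u = 0 ∧ qpolar B u w = 1 := by
  obtain ⟨y, hy⟩ : ∃ y, qpolar B y w ≠ 0 := by
    by_contra! h
    exact hwB ⟨h, hw⟩
  obtain ⟨u, hu⟩ : ∃ u, qpolar B u w = 1 :=
    ⟨(qpolar B y w)⁻¹ • y, by rw [qpolar_smul_left, inv_mul_cancel₀ hy]⟩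
  refine ⟨u + (-qval B u) • w, ?_, ?_⟩
  · rw [qval_add, qval_smul, hw, qpolar_smul_right, hu]
    ring
  · rw [qpolar_add_left, qpolar_smul_left, hu, qpolar_self, hw]
    ring

/-- A basis adapted to a hyperbolic plane `⟨u, w⟩` of `B` and a subspace of the radical of `B`. -/
theorem exists_adapted_matrix {B : Matrix (Fin n) (Fin n) K} {C : Submodule K (Fin n → K)}
    (hC : C ≤ radical B) {u w : Fin n → K} (hu : qval B u = 0) (hw : qval B w = 0)
    (huw : qpolar B u w = 1) :
    ∃ (T : Matrix (Fin n) (Fin n) K) (d : ℕ), IsUnit T.det ∧ d + 2 + Module.finrank K C = n ∧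
      (∀ i : Fin n, (i : ℕ) < d → qpolar B u (T.col i) = 0 ∧ qpolar B w (T.col i) = 0) ∧
      (∀ i : Fin n, (i : ℕ) = d → T.col i = u) ∧ (∀ i : Fin n, (i : ℕ) = d + 1 → T.col i = w) ∧
      ∀ i : Fin n, d + 2 ≤ i → T.col i ∈ C := by
  have hwu : qpolar B w u = 1 := by rw [qpolar_comm, huw]
  have huu : qpolar B u u = 0 := by rw [qpolar_self, hu, mul_zero]
  have hww : qpolar B w w = 0 := by rw [qpolar_self, hw, mul_zero]
  let H := LinearMap.ker (qpolarForm B u) ⊓ LinearMap.ker (qpolarForm B w)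
  have hCH : C ≤ H := fun x hx => ⟨(hC hx).1 u, (hC hx).1 w⟩
  have hzero (c : Fin 2 → K) (hc : ∑ i, c i • ![u, w] i ∈ H) : c = 0 := by
    simp only [Fin.sum_univ_two, Matrix.cons_val_zero, Matrix.cons_val_one, H, Submodule.mem_inf,
      mem_ker_qpolarForm, qpolar_add_right, qpolar_smul_right, huu, huw, hwu, hww] at hc
    ext i
    fin_cases i
    · simpa using hc.2
    · simpa using hc.1
  have hli : LinearIndependent K ![u, w] :=
    Fintype.linearIndependent_iff.2 fun c hc => congrFun (hzero c (hc ▸ H.zero_mem))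
  have hdisj : Disjoint (Submodule.span K (Set.range ![u, w])) H := by
    rw [Submodule.disjoint_def]
    intro x hx hxH
    obtain ⟨c, rfl⟩ := (Submodule.mem_span_range_iff_exists_fun K).1 hx
    rw [hzero c hxH]
    simp
  have hdimH : Module.finrank K H + 2 = n := by
    have h1 := Submodule.finrank_add_finrank_le_of_disjoint hdisj
    rw [finrank_span_eq_card hli, Fintype.card_fin, Module.finrank_fin_fun] at h1
    have h2 := finrank_le_finrank_inf_ker_add_one ⊤ (qpolarForm B u)
    have h3 := finrank_le_finrank_inf_ker_add_one (LinearMap.ker (qpolarForm B u)) (qpolarForm B w)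
    rw [finrank_top, Module.finrank_fin_fun, top_inf_eq] at h2
    change _ ≤ Module.finrank K H + 1 at h3
    omega
  obtain ⟨D₀, hD₀⟩ := Submodule.exists_isCompl C
  have hsup : D₀ ⊓ H ⊔ C = H := by
    rw [sup_comm, ← sup_inf_assoc_of_le D₀ hCH, hD₀.sup_eq_top, top_inf_eq]
  have hDC : Disjoint (D₀ ⊓ H) C := hD₀.disjoint.symm.mono_left inf_le_left
  have hdim := Submodule.finrank_sup_add_finrank_inf_eq (D₀ ⊓ H) C
  rw [hsup, hDC.eq_bot, finrank_bot] at hdim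
  obtain ⟨T, hT, hTD, hTu, hTC⟩ := exists_matrix_of_disjoint (D₀ ⊓ H) C ![u, w] hli hDC
    (by rwa [hsup]) (by omega)
  exact ⟨T, _, hT, by omega, fun i hi => (hTD i hi).2, fun i hi => hTu i 0 (by simpa using hi),
    fun i hi => hTu i 1 (by simpa using hi), hTC⟩

theorem exists_normal_form {A B : Matrix (Fin n) (Fin n) K} {w : Fin n → K} (hwA : w ∈ radical A)
    (hw : qval B w = 0) (hwB : w ∉ radical B) :
    ∃ (T A' B' : Matrix (Fin n) (Fin n) K) (l : Fin n → K) (i₀ i₁ : Fin n), IsUnit T.det ∧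
      i₀ + 2 + Module.finrank K (radical A ⊓ radical B : Submodule K (Fin n → K)) = n ∧
      (i₁ : ℕ) = i₀ + 1 ∧
      (∀ i, i₀ ≤ i → Pi.single i 1 ∈ radical A' ⊓ radical B') ∧ (∀ i, i₁ ≤ i → l i = 0) ∧
      (∀ x, qval (T.transpose * A * T) x = qval (A' + Matrix.vecMulVec (Pi.single i₀ 1) l) x) ∧
      ∀ x, qval (T.transpose * B * T) x =
        qval (B' + Matrix.vecMulVec (Pi.single i₀ 1) (Pi.single i₁ 1)) x := by
  obtain ⟨u, hu, huw⟩ := exists_hyperbolic_pair hw hwB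
  obtain ⟨T, d, hT, hd, hTD, hTu, hTw, hTC⟩ :=
    exists_adapted_matrix (C := radical A ⊓ radical B) inf_le_right hu hw huw
  let i₀ : Fin n := ⟨d, by omega⟩
  let i₁ : Fin n := ⟨d + 1, by omega⟩
  let P : Matrix (Fin n) (Fin n) K := Matrix.diagonal fun i => if i < i₀ then 1 else 0
  have hPi (i : Fin n) (hi : i₀ ≤ i) : P.mulVec (Pi.single i 1) = 0 := by
    ext j
    simp only [P, Matrix.mulVec_diagonal, Pi.single_apply, Pi.zero_apply]
    grind
  have hrad (M : Matrix (Fin n) (Fin n) K) (i : Fin n) (hi : i₀ ≤ i) :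
      Pi.single i 1 ∈ radical (P.transpose * M * P) := by
    refine ⟨fun y => ?_, ?_⟩
    · rw [qpolar_transpose_mul_mul, hPi i hi]
      simp [qpolar]
    · rw [qval_transpose_mul_mul, hPi i hi, qval_zero]
  let l : Fin n → K :=
    P.mulVec (T.transpose.mulVec ((A + A.transpose).mulVec u)) + qval A u • Pi.single i₀ 1
  have hl (x : Fin n → K) :
      l ⬝ᵥ x = qpolar A (T.mulVec (P.mulVec x)) u + x i₀ * qval A u := by
    have hP : P.transpose = P := Matrix.diagonal_transpose _
    simp only [l, add_dotProduct, qpolar, smul_dotProduct, single_one_dotProduct, smul_eq_mul]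
    rw [dotProduct_comm, Matrix.dotProduct_mulVec, ← Matrix.mulVec_transpose, hP,
      Matrix.dotProduct_mulVec, ← Matrix.mulVec_transpose, Matrix.transpose_transpose,
      mul_comm (x i₀)]
  have hdecomp (x : Fin n → K) : ∃ c ∈ radical A ⊓ radical B,
      T.mulVec x = T.mulVec (P.mulVec x) + x i₀ • u + x i₁ • w + c := by
    refine ⟨∑ i, (if i₁ < i then x i else 0) • T.col i, Submodule.sum_mem _ fun i _ => ?_, ?_⟩
    · by_cases hi : i₁ < i
      · exact Submodule.smul_mem _ _ (hTC i hi)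
      · simp [hi]
    · have h (y : Fin n → K) : T.mulVec y = ∑ i, y i • T.col i := by
        rw [Matrix.mulVec_eq_sum]
        exact Finset.sum_congr rfl fun i _ => op_smul_eq_smul _ _
      rw [h, h, show x i₀ • u = ∑ i, (if i = i₀ then x i else 0) • T.col i by
        simp [ite_smul, hTu i₀ rfl], show x i₁ • w = ∑ i, (if i = i₁ then x i else 0) • T.col i by
        simp [ite_smul, hTw i₁ rfl], ← Finset.sum_add_distrib, ← Finset.sum_add_distrib,
        ← Finset.sum_add_distrib]
      refine Finset.sum_congr rfl fun i _ => ?_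
      rw [← add_smul, ← add_smul, ← add_smul]
      congr 1
      simp only [P, Matrix.mulVec_diagonal]
      rcases lt_trichotomy (i : ℕ) d with hi | hi | hi
      · simp [i₀, i₁, Fin.ext_iff, Fin.lt_def, hi, hi.ne, show ¬ (d + 1 < (i : ℕ)) by omega,
          show (i : ℕ) ≠ d + 1 by omega]
      · simp [i₀, i₁, Fin.ext_iff, Fin.lt_def, hi]
      · rcases (Nat.succ_le_of_lt hi).eq_or_lt with hi' | hi'
        · simp [i₀, i₁, Fin.ext_iff, Fin.lt_def, ← hi']
        · simp [i₀, i₁, Fin.ext_iff, Fin.lt_def, hi.not_gt, hi.ne', hi'.ne',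
            show d + 1 < (i : ℕ) from hi']
  have hperp (v : Fin n → K) (hv : ∀ i : Fin n, (i : ℕ) < d → qpolar B v (T.col i) = 0)
      (x : Fin n → K) : qpolar B v (T.mulVec (P.mulVec x)) = 0 := by
    rw [Matrix.mulVec_eq_sum, qpolar_sum_right]
    refine Finset.sum_eq_zero fun i _ => ?_
    rw [op_smul_eq_smul, qpolar_smul_right]
    by_cases hi : (i : ℕ) < d
    · exact mul_eq_zero_of_right _ (hv i hi)
    · simp [P, Matrix.mulVec_diagonal, Fin.lt_def, i₀, hi]
  refine ⟨T, P.transpose * (T.transpose * A * T) * P, P.transpose * (T.transpose * B * T) * P, l,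
    i₀, i₁, hT, hd, rfl, fun i hi => ⟨hrad _ i hi, hrad _ i hi⟩, fun i hi => ?_, fun x => ?_,
    fun x => ?_⟩
  · have h1 : ¬ i < i₀ := by
      simp only [i₀, i₁, Fin.lt_def, Fin.le_def] at hi ⊢
      omega
    have h2 : i ≠ i₀ := by
      simp only [i₀, i₁, ne_eq, Fin.ext_iff, Fin.le_def] at hi ⊢
      omega
    simp only [l, P, Pi.add_apply, Matrix.mulVec_diagonal, Pi.smul_apply, Pi.single_apply, h1, h2,
      if_false, zero_mul, smul_zero, add_zero]
  · obtain ⟨c, hc, hx⟩ := hdecomp x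
    rw [qval_add_matrix, qval_vecMulVec, hl, qval_transpose_mul_mul, qval_transpose_mul_mul,
      qval_transpose_mul_mul, hx, mem_radical_iff_qval.1 hc.1,
      mem_radical_iff_qval.1 (Submodule.smul_mem _ _ hwA), qval_add, qval_smul, qpolar_smul_right,
      single_one_dotProduct]
    ring
  · obtain ⟨c, hc, hx⟩ := hdecomp x
    rw [qval_add_matrix, qval_vecMulVec, qval_transpose_mul_mul, qval_transpose_mul_mul,
      qval_transpose_mul_mul, hx, mem_radical_iff_qval.1 hc.2, qval_add, qval_add, qval_smul,
      qval_smul, qpolar_smul_right, qpolar_smul_right, qpolar_add_left, qpolar_smul_left, hu, hw,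
      huw, qpolar_comm, hperp u (fun i hi => (hTD i hi).1), qpolar_comm,
      hperp w (fun i hi => (hTD i hi).2), single_one_dotProduct, single_one_dotProduct]
    ring

end NormalForm

section Pencil

variable {K L : Type*} [Field K] [Field L] {n : ℕ}

theorem sum_C_single_mul_X (i : Fin n) :
    ∑ j, MvPolynomial.C ((Pi.single i 1 : Fin n → K) j) * MvPolynomial.X j =
      MvPolynomial.X (R := K) i := by
  simp [Pi.single_apply, ite_mul, apply_ite MvPolynomial.C]

theorem polyOf_eq_zero {A : Matrix (Fin n) (Fin n) K}
    (h : n ≤ Module.finrank K (radical A)) : polyOf A = 0 := by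
  have htop : radical A = ⊤ := by
    refine Submodule.eq_top_of_finrank_eq (le_antisymm (Submodule.finrank_le _) ?_)
    rwa [Module.finrank_fin_fun]
  rw [← polyOf_zero]
  refine polyOf_eq_of_qval_eq fun x => ?_
  rw [(htop ▸ Submodule.mem_top : x ∈ radical A).2]
  simp [qval]

theorem mem_radical_pencil {A B : Matrix (Fin n) (Fin n) K} {x : Fin n → K}
    (hA : x ∈ radical A) (hB : x ∈ radical B) (a b : K) : x ∈ radical (a • A + b • B) := by
  refine ⟨fun y => ?_, ?_⟩
  · rw [qpolar_add_matrix, qpolar_smul_matrix, qpolar_smul_matrix, hA.1, hB.1]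
    ring
  · rw [qval_add_matrix, qval_smul_matrix, qval_smul_matrix, hA.2, hB.2]
    ring

theorem comp_single (f : K →+* L) (i : Fin n) :
    f ∘ (Pi.single i 1 : Fin n → K) = Pi.single i 1 := by
  ext j
  simp [Pi.single_apply, apply_ite f]

open Polynomial in
theorem le_finrank_radical_left_of_pencil [Infinite K]
    (hK : (2 : K) = 0 → ∀ a : K, ∃ b, b ^ 2 = a) {A B : Matrix (Fin n) (Fin n) K} {d : ℕ}
    (h : ∀ b : K, b ≠ 0 → d ≤ Module.finrank K (radical (A + b • B))) :
    d ≤ Module.finrank K (radical A) := by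
  have hfam (t : K) : (A.map Polynomial.C + (Polynomial.X : K[X]) • B.map Polynomial.C).map
      (evalRingHom t) = A + t • B := by
    ext i j
    simpa using mul_comm _ _
  have := le_finrank_radical_eval_zero hK
    (A.map Polynomial.C + (Polynomial.X : K[X]) • B.map Polynomial.C) d fun t ht => by
      rw [hfam]
      exact h t ht
  rwa [hfam, zero_smul, add_zero] at this

/-- Removing the variables of the hyperbolic plane from a normal form lowers all ranks by two. -/
theorem le_finrank_radical_reduced [Infinite L] (f : K →+* L)
    (hL : (2 : L) = 0 → ∀ a : L, ∃ b, b ^ 2 = a) {A B T A' B' : Matrix (Fin n) (Fin n) K}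
    {l : Fin n → K} {i₀ i₁ : Fin n} {d : ℕ} (hT : IsUnit T.det) (hi : i₀ < i₁)
    (hrad : ∀ i, i₀ ≤ i → Pi.single i 1 ∈ radical A' ⊓ radical B') (hl : l i₁ = 0)
    (hA : ∀ x, qval (T.transpose * A * T) x =
      qval (A' + Matrix.vecMulVec (Pi.single i₀ 1) l) x)
    (hB : ∀ x, qval (T.transpose * B * T) x =
      qval (B' + Matrix.vecMulVec (Pi.single i₀ 1) (Pi.single i₁ 1)) x)
    (h : ∀ a b : L, a ≠ 0 ∨ b ≠ 0 →
      d ≤ Module.finrank L (radical (a • A.map f + b • B.map f)))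
    (a b : L) (hab : a ≠ 0 ∨ b ≠ 0) :
    d + 2 ≤ Module.finrank L (radical (a • A'.map f + b • B'.map f)) := by
  have main (a b : L) (hb : b ≠ 0) :
      d + 2 ≤ Module.finrank L (radical (a • A'.map f + b • B'.map f)) := by
    have hmem (i : Fin n) (hi : i₀ ≤ i) :
        Pi.single i 1 ∈ radical (a • A'.map f + b • B'.map f) := by
      rw [← comp_single f]
      exact mem_radical_pencil (comp_mem_radical_map f (hrad i hi).1)
        (comp_mem_radical_map f (hrad i hi).2) a b
    refine le_trans ?_ (finrank_radical_add_vecMulVec_add_two_le (f := Pi.single i₀ 1)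
      (g := a • f ∘ l + b • Pi.single i₁ 1) (hmem i₀ le_rfl) (hmem i₁ hi.le) ?_ ?_ ?_)
    · refine Nat.add_le_add_right ((h a b (Or.inr hb)).trans_eq ?_) 2
      have hTL : IsUnit (T.map f).det := by
        have := hT.map f
        rwa [RingHom.map_det] at this
      rw [← finrank_radical_congr _ _ hTL]
      refine congrArg (fun S : Submodule L (Fin n → L) => Module.finrank L S)
        (radical_congr fun x => ?_)
      have hA' := qval_map_eq f hA x
      have hB' := qval_map_eq f hB x
      have hv (u v : Fin n → K) : (Matrix.vecMulVec u v).map f =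
          Matrix.vecMulVec (f ∘ u) (f ∘ v) := by
        ext; simp [Matrix.vecMulVec_apply]
      rw [Matrix.map_mul, Matrix.map_mul, Matrix.transpose_map, qval_transpose_mul_mul,
        Matrix.map_add _ (map_add f), hv, qval_add_matrix, qval_vecMulVec, comp_single] at hA' hB'
      rw [comp_single] at hB'
      simp only [qval_transpose_mul_mul, qval_add_matrix, qval_smul_matrix, qval_vecMulVec, hA',
        hB', add_dotProduct, smul_dotProduct, smul_eq_mul]
      ring
    · simp
    · simp [hi.ne]
    · simp [hl, hb]
  by_cases hb : b = 0
  · subst hb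
    rw [zero_smul, add_zero]
    exact le_finrank_radical_left_of_pencil hL (B := B'.map f) fun b hb => main a b hb
  · exact main a b hb

theorem finrank_inf_radical_reduced_le {A B T A' B' : Matrix (Fin n) (Fin n) K}
    {f₁ f₂ f₃ : Fin n → K} (hT : IsUnit T.det)
    (hA : ∀ x, qval (T.transpose * A * T) x = qval (A' + Matrix.vecMulVec f₁ f₂) x)
    (hB : ∀ x, qval (T.transpose * B * T) x = qval (B' + Matrix.vecMulVec f₁ f₃) x) :
    Module.finrank K (radical A' ⊓ radical B' : Submodule K (Fin n → K)) ≤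
      Module.finrank K (radical A ⊓ radical B : Submodule K (Fin n → K)) + 3 := by
  have h1 := finrank_le_finrank_inf_ker_add_one (radical A' ⊓ radical B')
    (dotProductEquiv K (Fin n) f₁)
  have h2 := finrank_le_finrank_inf_ker_add_one
    (radical A' ⊓ radical B' ⊓ LinearMap.ker (dotProductEquiv K (Fin n) f₁))
    (dotProductEquiv K (Fin n) f₂)
  have h3 := finrank_le_finrank_inf_ker_add_one
    (radical A' ⊓ radical B' ⊓ LinearMap.ker (dotProductEquiv K (Fin n) f₁) ⊓
      LinearMap.ker (dotProductEquiv K (Fin n) f₂)) (dotProductEquiv K (Fin n) f₃)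
  set S := radical A' ⊓ radical B' ⊓ LinearMap.ker (dotProductEquiv K (Fin n) f₁) ⊓
      LinearMap.ker (dotProductEquiv K (Fin n) f₂) ⊓ LinearMap.ker (dotProductEquiv K (Fin n) f₃)
  have hS : S.map T.mulVecLin ≤ radical A ⊓ radical B := by
    rintro _ ⟨x, ⟨⟨⟨⟨hxA, hxB⟩, hx1⟩, hx2⟩, hx3⟩, rfl⟩
    refine ⟨(mem_radical_transpose_mul_mul hT).1 ?_, (mem_radical_transpose_mul_mul hT).1 ?_⟩
    · rw [radical_congr hA]
      exact mem_radical_add_vecMulVec hxA hx1 hx2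
    · rw [radical_congr hB]
      exact mem_radical_add_vecMulVec hxB hx1 hx3
  have hinj : Function.Injective T.mulVecLin :=
    Matrix.mulVec_injective_of_isUnit ((Matrix.isUnit_iff_isUnit_det T).2 hT)
  have h4 := Submodule.finrank_mono hS
  rw [← (Submodule.equivMapOfInjective _ hinj S).finrank_eq] at h4
  omega

theorem le_finrank_inf_radical {A B : Matrix (Fin n) (Fin n) K} {i₀ : Fin n}
    (hrad : ∀ i, i₀ ≤ i → Pi.single i 1 ∈ radical A ⊓ radical B) :
    n ≤ Module.finrank K (radical A ⊓ radical B : Submodule K (Fin n → K)) + i₀ := by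
  have := sInf_setOf_exists_matrix (radical A ⊓ radical B)
  have h2 : sInf {m : ℕ | ∃ T : Matrix (Fin n) (Fin n) K, IsUnit T.det ∧
      ∀ i : Fin n, m ≤ i → T.col i ∈ radical A ⊓ radical B} ≤ i₀ := by
    refine Nat.sInf_le ⟨1, by simp, fun i hi => ?_⟩
    rw [← Matrix.mulVec_single_one, Matrix.one_mulVec]
    exact hrad i hi
  omega

end Pencil

theorem residueField_finite (k : Type*) [Field k] [NumberField k] (v : HeightOneSpectrum (𝓞 k)) :
    Finite (IsLocalRing.ResidueField (v.adicCompletionIntegers k)) := by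
  let O := v.adicCompletionIntegers k
  let f : 𝓞 k →+* IsLocalRing.ResidueField O :=
    (IsLocalRing.residue O).comp (algebraMap (𝓞 k) O)
  have hres (x : O) (hx : Valued.v (x : v.adicCompletion k) < 1) :
      IsLocalRing.residue O x = 0 := by
    rw [IsLocalRing.residue_eq_zero_iff, IsLocalRing.mem_maximalIdeal, mem_nonunits_iff,
      HeightOneSpectrum.adicCompletionIntegers.isUnit_iff_valued_eq_one]
    exact hx.ne
  have hker : ∀ a ∈ v.asIdeal, f a = 0 := by
    intro a ha
    refine hres _ ?_
    rw [HeightOneSpectrum.algebraMap_adicCompletionIntegers_apply,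
      HeightOneSpectrum.valuedAdicCompletion_eq_valuation']
    exact (v.valuation_lt_one_iff_mem a).2 ha
  have : Finite (𝓞 k ⧸ v.asIdeal) := Ideal.finiteQuotientOfFreeOfNeBot _ v.ne_bot
  refine Finite.of_surjective (Ideal.Quotient.lift v.asIdeal f hker) ?_
  refine Ideal.Quotient.lift_surjective_of_surjective _ _ fun y => ?_
  obtain ⟨x, rfl⟩ := IsLocalRing.residue_surjective y
  have hopen : IsOpen {y : v.adicCompletion k | Valued.v (y - x) < 1} := by
    have h := Valued.isOpen_ball (v.adicCompletion k) 1
    have h' : IsOpen {z : v.adicCompletion k | Valued.v z < 1} := by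
      convert h using 3
      simp [Valuation.restrict_lt_one_iff]
    exact h'.preimage (continuous_sub_right _)
  obtain ⟨y, hy⟩ := (HeightOneSpectrum.denseRange_algebraMap (R := 𝓞 k) (K := k) v).exists_mem_open
    hopen ⟨x, by simp⟩
  have hy : Valued.v ((y : v.adicCompletion k) - x) < 1 := hy
  have hyle : v.valuation k y ≤ 1 := by
    rw [← HeightOneSpectrum.valuedAdicCompletion_eq_valuation']
    have := Valuation.map_add Valued.v ((y : v.adicCompletion k) - x) x
    rw [sub_add_cancel] at this
    exact this.trans (max_le hy.le x.2)
  obtain ⟨a, ha⟩ := v.exists_valuation_sub_lt_of_integer hyle 1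
  refine ⟨a, ?_⟩
  rw [← sub_eq_zero]
  show IsLocalRing.residue O _ - _ = 0
  rw [← map_sub]
  refine hres _ ?_
  have h1 : Valued.v ((algebraMap (𝓞 k) k a - y : k) : v.adicCompletion k) < 1 := by
    rw [HeightOneSpectrum.valuedAdicCompletion_eq_valuation']
    exact ha
  have h2 := (Valuation.map_add Valued.v _ _).trans_lt (max_lt h1 hy)
  convert h2 using 2
  have hsub : ((algebraMap (𝓞 k) k a - y : k) : v.adicCompletion k) =
      (algebraMap (𝓞 k) k a : k) - (y : v.adicCompletion k) :=
    map_sub (algebraMap k (v.adicCompletion k)) _ _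
  rw [hsub, sub_add_sub_cancel]
  rfl

theorem exists_sq_eq_of_finite {K : Type*} [Field K] [Finite K] (h2 : (2 : K) = 0) (a : K) :
    ∃ b, b ^ 2 = a := by
  have : CharP K 2 := CharTwo.of_one_ne_zero_of_two_eq_zero one_ne_zero h2
  exact (bijective_frobenius K 2).2 a

/-- Lemma `r-2`: let `q₁, q₂` generate a pencil of quadratic forms in `n`
variables over a residue field `F` of the completion of a number field at a non-archimedean
place, with `#F ≥ n`.  Suppose `r = r(P) < R = R(P)` and either `r` is even or `r ≤ R - 2`.
Then `r ≥ 2`, and if moreover `rank q₁ = r` there is an invertible change of variables such that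
`q₁ = q₃(X_1,…,X_{R-2}) + X_{R-1}ℓ(X_1,…,X_{R-1})` and `q₂ = q₄(X_1,…,X_{R-2}) + X_{R-1}X_R`,
with `rank q₃ = r(q₃,q₄) = r - 2` and `R(q₃,q₄) ∈ {R-3, R-2}`; in particular if `r = 2` then
`q₃` and `q₄` vanish identically. -/
theorem stmt_12 {F : Type*} [Field F] {n : ℕ}
    (k : Type*) [Field k] [NumberField k] (v : HeightOneSpectrum (𝓞 k))
    (hres : Nonempty (F ≃+* IsLocalRing.ResidueField (v.adicCompletionIntegers k)))
    (hcardF : (n : Cardinal) ≤ Cardinal.mk F)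
    (q₁ q₂ : MvPolynomial (Fin n) F)
    (hq₁ : q₁.IsHomogeneous 2) (hq₂ : q₂.IsHomogeneous 2)
    (hindep : LinearIndependent F ![q₁, q₂])
    (r R : ℕ) (hrdef : r = pencilRmax q₁ q₂) (hRdef : R = pencilR q₁ q₂)
    (hrR : r < R) (hcase : Even r ∨ r + 2 ≤ R) :
    2 ≤ r ∧
    (qRank q₁ = r →
      ∃ T : Matrix (Fin n) (Fin n) F, IsUnit T.det ∧
        ∃ (q₃ q₄ ℓ : MvPolynomial (Fin n) F) (h₁ : R - 2 < n) (h₂ : R - 1 < n),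
          DependsOnlyOnFirst (R - 2) q₃ ∧ DependsOnlyOnFirst (R - 2) q₄ ∧
          ℓ.IsHomogeneous 1 ∧ DependsOnlyOnFirst (R - 1) ℓ ∧
          substMat T q₁ = q₃ + MvPolynomial.X (⟨R - 2, h₁⟩ : Fin n) * ℓ ∧
          substMat T q₂ = q₄ +
            MvPolynomial.X (⟨R - 2, h₁⟩ : Fin n) * MvPolynomial.X (⟨R - 1, h₂⟩ : Fin n) ∧
          qRank q₃ = r - 2 ∧ pencilRmax q₃ q₄ = r - 2 ∧
          (pencilR q₃ q₄ = R - 3 ∨ pencilR q₃ q₄ = R - 2) ∧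
          (r = 2 → q₃ = 0 ∧ q₄ = 0)) := by
  have hfin : Finite F :=
    have := residueField_finite k v
    Finite.of_equiv _ hres.some.toEquiv.symm
  have hF (h2 : (2 : F) = 0) := exists_sq_eq_of_finite h2
  have hL (_ : (2 : AlgebraicClosure F) = 0) (a : AlgebraicClosure F) :=
    IsAlgClosed.exists_pow_nat_eq a two_pos
  obtain ⟨A, rfl⟩ := exists_polyOf_eq hq₁
  obtain ⟨B, rfl⟩ := exists_polyOf_eq hq₂
  obtain ⟨f, hf⟩ : ∃ f, f = algebraMap F (AlgebraicClosure F) := ⟨_, rfl⟩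
  have hpencil (a b : AlgebraicClosure F) (hab : a ≠ 0 ∨ b ≠ 0) :
      n - r ≤ Module.finrank (AlgebraicClosure F) (radical (a • A.map f + b • B.map f)) := by
    have := le_pencilRmax_polyOf A B hab
    rw [← hf] at this
    omega
  have hdim (S : Submodule F (Fin n → F)) : Module.finrank F S ≤ n := by
    simpa using S.finrank_le
  rw [pencilR_polyOf] at hRdef
  have hinf := hdim (radical A ⊓ radical B)
  have hA : n - r ≤ Module.finrank F (radical A) := by
    have := hpencil 1 0 (Or.inl one_ne_zero)
    rw [one_smul, zero_smul, add_zero] at this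
    exact this.trans (finrank_radical_map_le hF f A)
  have hB : n - r ≤ Module.finrank F (radical B) := by
    have := hpencil 0 1 (Or.inr one_ne_zero)
    rw [one_smul, zero_smul, zero_add] at this
    exact this.trans (finrank_radical_map_le hF f B)
  have h2r : 2 ≤ r := by
    have h1 := Submodule.finrank_sup_add_finrank_inf_eq (radical A) (radical B)
    have h2 := hdim (radical A ⊔ radical B)
    rcases hcase with ⟨s, hs⟩ | h <;> omega
  refine ⟨h2r, fun hrank => ?_⟩
  rw [qRank_polyOf] at hrank
  obtain ⟨w, hwA, hw, hwB⟩ := exists_isotropic_mem_radical f hF hL (A := A) (B := B) (r := r)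
    (R := R) (by omega) (by omega) (fun a => by
      have := hpencil a 1 (Or.inr one_ne_zero)
      rw [one_smul] at this
      omega) hrR hcase
  obtain ⟨T, A', B', l, i₀, i₁, hT, hi₀, hi₁, hrad, hl, hTA, hTB⟩ :=
    exists_normal_form hwA hw hwB
  have hlt : i₀ < i₁ := by
    rw [Fin.lt_def]
    omega
  have hred := le_finrank_radical_reduced f hL hT hlt hrad (hl i₁ le_rfl) hTA hTB hpencil
  have hA'L : n - r + 2 ≤ Module.finrank (AlgebraicClosure F) (radical (A'.map f)) := by
    have := hred 1 0 (Or.inl one_ne_zero)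
    rwa [one_smul, zero_smul, add_zero] at this
  have hB'L : n - r + 2 ≤ Module.finrank (AlgebraicClosure F) (radical (B'.map f)) := by
    have := hred 0 1 (Or.inr one_ne_zero)
    rwa [one_smul, zero_smul, zero_add] at this
  have hA'map := finrank_radical_map_le hF f A'
  have hB'map := finrank_radical_map_le hF f B'
  have hA' : Module.finrank F (radical A') ≤ n - r + 2 := by
    have := finrank_radical_le_add_vecMulVec A' (Pi.single i₀ 1) l
    rw [← radical_congr hTA, finrank_radical_congr _ _ hT] at this
    omega
  have hsub₀ : (⟨R - 2, by omega⟩ : Fin n) = i₀ := Fin.ext (by simp only; omega)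
  have hsub₁ : (⟨R - 1, by omega⟩ : Fin n) = i₁ := Fin.ext (by simp only; omega)
  refine ⟨T, hT, polyOf A', polyOf B', ∑ i, MvPolynomial.C (l i) * MvPolynomial.X i, by omega,
    by omega, ?_, ?_, ?_, ?_, ?_, ?_, ?_, ?_, ?_, ?_⟩
  · exact dependsOnlyOnFirst_polyOf_iff.2 fun i hi => (hrad i (by rw [Fin.le_def]; omega)).1
  · exact dependsOnlyOnFirst_polyOf_iff.2 fun i hi => (hrad i (by rw [Fin.le_def]; omega)).2
  · exact MvPolynomial.IsHomogeneous.sum _ _ _ fun i _ => MvPolynomial.isHomogeneous_C_mul_X _ _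
  · exact dependsOnlyOnFirst_sum _ fun i hi => hl i (by rw [Fin.le_def]; omega)
  · rw [substMat_polyOf, polyOf_eq_of_qval_eq hTA, polyOf_add, polyOf_vecMulVec,
      sum_C_single_mul_X, hsub₀]
  · rw [substMat_polyOf, polyOf_eq_of_qval_eq hTB, polyOf_add, polyOf_vecMulVec,
      sum_C_single_mul_X, sum_C_single_mul_X, hsub₀, hsub₁]
  · rw [qRank_polyOf]
    omega
  · apply le_antisymm
    · refine pencilRmax_polyOf_le _ _ fun a b hab => ?_
      have := hred a b hab
      rw [← hf]
      omega
    · refine le_trans ?_ (le_pencilRmax_polyOf A' B' (a := 1) (b := 0) (Or.inl one_ne_zero))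
      rw [← hf, one_smul, zero_smul, add_zero]
      omega
  · rw [pencilR_polyOf]
    have h1 := finrank_inf_radical_reduced_le hT hTA hTB
    have h2 := le_finrank_inf_radical hrad
    have h3 : n ≤ Module.finrank F (radical A' ⊓ radical B' : Submodule F (Fin n → F)) +
        (R - 2) := by omega
    omega
  · rintro rfl
    exact ⟨polyOf_eq_zero (by omega), polyOf_eq_zero (by omega)⟩
end

section
/- Let q_1 and q_2 be quadratic forms in 4 variables over a finite field F. If r(q_1,q_2) < 4 then q_1 and q_2 have a singular common zero over F; that is, there is a nonzero vector x in F^4 with q_1(x) = q_2(x) = 0 such that the gradients ∇q_1(x) and ∇q_2(x) are proportional. -/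
open MvPolynomial NumberField IsDedekindDomain

/-- A quadratic form is given by a (not necessarily symmetric) matrix of coefficients. -/
theorem MvPolynomial.IsHomogeneous.exists_matrix_of_two {R σ : Type*} [CommRing R] [Fintype σ]
    {q : MvPolynomial σ R} (hq : q.IsHomogeneous 2) :
    ∃ A : Matrix σ σ R, q = ∑ i, ∑ j, C (A i j) * (X i * X j) := by
  classical
  rw [q.as_sum]
  have key : ∀ s : Finset (σ →₀ ℕ), s ⊆ q.support →
      ∃ A : Matrix σ σ R, ∑ d ∈ s, monomial d (q.coeff d) = ∑ i, ∑ j, C (A i j) * (X i * X j) := by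
    intro s
    induction s using Finset.induction_on with
    | empty => exact fun _ => ⟨0, by simp⟩
    | insert d s hd ih =>
      intro hs
      obtain ⟨A, hA⟩ := ih ((Finset.subset_insert _ _).trans hs)
      have hdeg : d.degree = 2 := by
        have := hq (mem_support_iff.1 (hs (Finset.mem_insert_self d s)))
        rwa [Finsupp.degree_eq_weight_one]
      obtain ⟨i, hi⟩ : ∃ i, d i ≠ 0 := by
        by_contra! h
        have : d = 0 := Finsupp.ext h
        simp [this] at hdeg
      obtain ⟨e, rfl⟩ : ∃ e, d = Finsupp.single i 1 + e :=
        ⟨d - Finsupp.single i 1, (add_tsub_cancel_of_le (by simpa [Nat.one_le_iff_ne_zero])).symm⟩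
      have he : e.degree = 1 := by
        rw [map_add, Finsupp.degree_single] at hdeg
        omega
      obtain ⟨j, rfl⟩ : ∃ j, e = Finsupp.single j 1 := by
        obtain ⟨j, hj⟩ : ∃ j, e j ≠ 0 := by
          by_contra! h
          have : e = 0 := Finsupp.ext h
          simp [this] at he
        obtain ⟨f, rfl⟩ : ∃ f, e = Finsupp.single j 1 + f :=
          ⟨e - Finsupp.single j 1, (add_tsub_cancel_of_le (by simpa [Nat.one_le_iff_ne_zero])).symm⟩
        rw [map_add, Finsupp.degree_single, Nat.add_eq_left, Finsupp.degree_eq_zero_iff] at he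
        exact ⟨j, by rw [he, add_zero]⟩
      refine ⟨A + Matrix.single i j (q.coeff (Finsupp.single i 1 + Finsupp.single j 1)), ?_⟩
      rw [Finset.sum_insert hd, hA]
      simp only [Matrix.add_apply, map_add, add_mul, Finset.sum_add_distrib]
      rw [add_comm]
      congr 1
      rw [Finset.sum_eq_single i, Finset.sum_eq_single j]
      · simp [X, C_mul_monomial, monomial_mul]
      · intro b _ hb
        simp [Matrix.single_apply_of_col_ne _ _ hb.symm]
      · simp
      · intro b _ hb
        exact Finset.sum_eq_zero fun k _ => by simp [Matrix.single_apply_of_row_ne hb.symm]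
      · simp
  exact key _ subset_rfl

section Matrix

open Matrix

variable {σ : Type*} [Fintype σ]

theorem eval_sum_C_mul_X_mul_X {R : Type*} [CommRing R] (A : Matrix σ σ R) (x : σ → R) :
    eval x (∑ i, ∑ j, C (A i j) * (X i * X j)) = x ⬝ᵥ A *ᵥ x := by
  simp only [map_sum, map_mul, eval_C, eval_X, dotProduct, mulVec, Finset.mul_sum]
  exact Finset.sum_congr rfl fun i _ => Finset.sum_congr rfl fun j _ => by ring

theorem eval_pderiv_sum_C_mul_X_mul_X {R : Type*} [CommRing R] (A : Matrix σ σ R) (x : σ → R)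
    (k : σ) :
    eval x (pderiv k (∑ i, ∑ j, C (A i j) * (X i * X j))) = ((A + Aᵀ) *ᵥ x) k := by
  classical
  simp only [map_sum, Derivation.leibniz, pderiv_C, pderiv_X, smul_eq_mul, mul_zero, add_zero,
    map_mul, map_add, eval_C, eval_X, mul_add, Finset.sum_add_distrib, add_mulVec, Pi.add_apply]
  rw [add_comm]
  congr 1
  · rw [Finset.sum_eq_single k]
    · simp [mulVec, dotProduct]
    · intro b _ hb
      simp [hb]
    · simp
  · rw [Finset.sum_comm, Finset.sum_eq_single k]
    · simp [mulVec, dotProduct]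
    · intro b _ hb
      simp [hb]
    · simp

theorem polar_dotProduct_mulVec {R : Type*} [CommRing R] (A : Matrix σ σ R) (x y : σ → R) :
    (x + y) ⬝ᵥ A *ᵥ (x + y) = x ⬝ᵥ A *ᵥ x + y ⬝ᵥ A *ᵥ y + x ⬝ᵥ (A + Aᵀ) *ᵥ y := by
  rw [mulVec_add, add_dotProduct, dotProduct_add, dotProduct_add, add_mulVec, dotProduct_add,
    mulVec_transpose, dotProduct_comm x (y ᵥ* A), ← dotProduct_mulVec]
  ring

end Matrix

theorem eval_substMat {K : Type*} [CommRing K] {n : ℕ} (T : Matrix (Fin n) (Fin n) K)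
    (q : MvPolynomial (Fin n) K) (x : Fin n → K) :
    eval x (substMat T q) = eval (T.mulVec x) q := by
  rw [substMat, aeval_def, algebraMap_eq, ← coe_eval₂Hom, ← RingHom.comp_apply]
  refine congrArg (fun f : MvPolynomial (Fin n) K →+* K => f q) ?_
  ext i <;> simp [Matrix.mulVec, dotProduct]

theorem qRank_le {K : Type*} [Field K] {n : ℕ} (q : MvPolynomial (Fin n) K) : qRank q ≤ n :=
  Nat.sInf_le ⟨1, by simp, fun i _ => i.2⟩

theorem qRank_le_pencilRmax {K : Type*} [Field K] {n : ℕ} (q₁ q₂ : MvPolynomial (Fin n) K)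
    {a b : AlgebraicClosure K} (hab : a ≠ 0 ∨ b ≠ 0) :
    qRank (C a * map (algebraMap K (AlgebraicClosure K)) q₁ +
      C b * map (algebraMap K (AlgebraicClosure K)) q₂) ≤ pencilRmax q₁ q₂ := by
  refine le_csSup ⟨n, ?_⟩ ⟨a, b, hab, rfl⟩
  rintro _ ⟨_, _, _, rfl⟩
  exact qRank_le _

/-- A form of less than full rank is invariant under translation by some nonzero vector. -/
theorem exists_eval_add_eq_of_qRank_lt {K : Type*} [Field K] {n : ℕ} (q : MvPolynomial (Fin n) K)
    (h : qRank q < n) : ∃ v : Fin n → K, v ≠ 0 ∧ ∀ y, eval (y + v) q = eval y q := by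
  obtain ⟨T, hT, hdep⟩ := Nat.sInf_mem (s := {m | ∃ T : Matrix (Fin n) (Fin n) K,
    IsUnit T.det ∧ DependsOnlyOnFirst m (substMat T q)}) ⟨n, 1, by simp, fun i _ => i.2⟩
  have hu : IsUnit T := (Matrix.isUnit_iff_isUnit_det T).2 hT
  let e : Fin n → K := Pi.single ⟨qRank q, h⟩ 1
  refine ⟨T.mulVec e, fun h0 => ?_, fun y => ?_⟩
  · have : e = 0 := Matrix.mulVec_injective_of_isUnit hu (by simpa using h0)
    simpa [e] using congrFun this ⟨qRank q, h⟩
  · obtain ⟨z, rfl⟩ := Matrix.mulVec_surjective_iff_isUnit.2 hu y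
    rw [← Matrix.mulVec_add, ← eval_substMat, ← eval_substMat]
    refine eval₂Hom_congr' rfl (fun i hi _ => ?_) rfl
    have : i ≠ ⟨qRank q, h⟩ := fun hh => (hdep i hi).ne (congrArg Fin.val hh)
    simp [e, this]

open Matrix in
theorem det_add_transpose_eq_zero_of_qRank_lt {K : Type*} [Field K] {n : ℕ}
    (A : Matrix (Fin n) (Fin n) K) (h : qRank (∑ i, ∑ j, C (A i j) * (X i * X j)) < n) :
    (A + Aᵀ).det = 0 := by
  obtain ⟨v, hv, hinv⟩ := exists_eval_add_eq_of_qRank_lt _ h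
  refine exists_mulVec_eq_zero_iff.1 ⟨v, hv, dotProduct_eq_zero _ fun y => ?_⟩
  have h0 := hinv 0
  have hy := hinv y
  simp only [eval_sum_C_mul_X_mul_X, zero_add, polar_dotProduct_mulVec, zero_dotProduct] at h0 hy
  rw [dotProduct_comm]
  linear_combination hy - h0

open Matrix in
/-- If a pencil of symmetric matrices is singular as a matrix of polynomials, then some nonzero `v`
is killed by `M₁` and has `M₂ v` in the image of `M₁`. -/
theorem exists_mulVec_eq_zero_and_mulVec_add_eq_zero {F σ : Type*} [Field F] [Fintype σ]
    [DecidableEq σ] (M₁ M₂ : Matrix σ σ F)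
    (h : (M₁.map Polynomial.C + (Polynomial.X : Polynomial F) • M₂.map Polynomial.C).det = 0) :
    ∃ v w : σ → F, v ≠ 0 ∧ M₁ *ᵥ v = 0 ∧ M₁ *ᵥ w + M₂ *ᵥ v = 0 := by
  classical
  obtain ⟨p, hp, hker⟩ := exists_mulVec_eq_zero_iff.2 h
  let _ : NormalizedGCDMonoid (Polynomial F) :=
    UniqueFactorizationMonoid.toNormalizedGCDMonoid _
  obtain ⟨i₀, hi₀⟩ := Function.ne_iff.1 hp
  obtain ⟨g, hg, hg1⟩ := Finset.extract_gcd p ⟨i₀, Finset.mem_univ i₀⟩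
  have hpg : p = Finset.univ.gcd p • g := funext fun i => hg i (Finset.mem_univ i)
  have hd : Finset.univ.gcd p ≠ 0 := fun hd => hi₀ (by rw [hg i₀ (Finset.mem_univ _), hd]; simp)
  rw [hpg, mulVec_smul, smul_eq_zero, or_iff_right hd] at hker
  have hcoeff : ∀ i, ∑ j, (Polynomial.C (M₁ i j) * g j +
      Polynomial.X * (Polynomial.C (M₂ i j) * g j)) = 0 := by
    intro i
    refine Eq.trans ?_ (congrFun hker i)
    simp only [mulVec, dotProduct, Matrix.add_apply, Matrix.smul_apply, Matrix.map_apply,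
      smul_eq_mul]
    exact Finset.sum_congr rfl fun j _ => by ring
  refine ⟨fun i => (g i).coeff 0, fun i => (g i).coeff 1, fun h0 => ?_, funext fun i => ?_,
    funext fun i => ?_⟩
  · have : (Polynomial.X : Polynomial F) ∣ Finset.univ.gcd g :=
      Finset.dvd_gcd fun i _ => Polynomial.X_dvd_iff.2 (congrFun h0 i)
    rw [hg1] at this
    exact Polynomial.not_isUnit_X (isUnit_of_dvd_one this)
  · simpa [mulVec, dotProduct, Polynomial.finsetSum_coeff] using
      congrArg (fun r => Polynomial.coeff r 0) (hcoeff i)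
  · simpa [mulVec, dotProduct, Polynomial.finsetSum_coeff, Finset.sum_add_distrib,
      Polynomial.coeff_X_mul] using congrArg (fun r => Polynomial.coeff r 1) (hcoeff i)

open Matrix in
theorem exists_singular_zero_of_two_ne_zero {F σ : Type*} [Field F] [Fintype σ]
    [DecidableEq σ] (h2 : (2 : F) ≠ 0) (A₁ A₂ : Matrix σ σ F)
    (h : ((A₁ + A₁ᵀ).map Polynomial.C +
      (Polynomial.X : Polynomial F) • (A₂ + A₂ᵀ).map Polynomial.C).det = 0) :
    ∃ x : σ → F, x ≠ 0 ∧ x ⬝ᵥ A₁ *ᵥ x = 0 ∧ x ⬝ᵥ A₂ *ᵥ x = 0 ∧ (A₁ + A₁ᵀ) *ᵥ x = 0 := by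
  obtain ⟨v, w, hv, h1, h3⟩ := exists_mulVec_eq_zero_and_mulVec_add_eq_zero _ _ h
  have hdiag : ∀ A : Matrix σ σ F, v ⬝ᵥ (A + Aᵀ) *ᵥ v = 2 * (v ⬝ᵥ A *ᵥ v) := by
    intro A
    rw [add_mulVec, dotProduct_add, mulVec_transpose, dotProduct_comm v (v ᵥ* A),
      ← dotProduct_mulVec]
    ring
  refine ⟨v, hv, ?_, ?_, h1⟩
  · have := hdiag A₁
    rw [h1, dotProduct_zero] at this
    simpa [h2] using this.symm
  · have := hdiag A₂
    have hs : (A₁ + A₁ᵀ)ᵀ = A₁ + A₁ᵀ := by rw [transpose_add, transpose_transpose, add_comm]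
    rw [eq_neg_of_add_eq_zero_right h3, dotProduct_neg, dotProduct_mulVec, ← mulVec_transpose,
      hs, h1, zero_dotProduct, neg_zero] at this
    simpa [h2] using this.symm

section Alternating

open Matrix

variable {F : Type*} [Field F]

/-- The Pfaffian of an alternating `4 × 4` matrix. -/
def pfaffianFour (M : Matrix (Fin 4) (Fin 4) F) : F :=
  M 0 1 * M 2 3 - M 0 2 * M 1 3 + M 0 3 * M 1 2

/-- The Hodge dual of an alternating `4 × 4` matrix; `hodgeFour M *ᵥ a` lists the coordinates of
the wedge product of `M` and `a`. -/
def hodgeFour (M : Matrix (Fin 4) (Fin 4) F) : Matrix (Fin 4) (Fin 4) F :=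
  !![0, M 2 3, -M 1 3, M 1 2;
    -M 2 3, 0, M 0 3, -M 0 2;
    M 1 3, -M 0 3, 0, M 0 1;
    -M 1 2, M 0 2, -M 0 1, 0]

theorem hodgeFour_add (M N : Matrix (Fin 4) (Fin 4) F) :
    hodgeFour (M + N) = hodgeFour M + hodgeFour N := by
  ext i j
  fin_cases i <;> fin_cases j <;> simp [hodgeFour, add_comm]

theorem hodgeFour_transpose (M : Matrix (Fin 4) (Fin 4) F) :
    (hodgeFour M)ᵀ = -hodgeFour M := by
  ext i j
  fin_cases i <;> fin_cases j <;> simp [hodgeFour]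

theorem hodgeFour_zero : hodgeFour (0 : Matrix (Fin 4) (Fin 4) F) = 0 := by
  ext i j
  fin_cases i <;> fin_cases j <;> simp [hodgeFour]

theorem det_eq_pfaffianFour_sq {M : Matrix (Fin 4) (Fin 4) F} (hM : Mᵀ = -M)
    (hd : ∀ i, M i i = 0) : M.det = pfaffianFour M ^ 2 := by
  have h : ∀ i j, M j i = -M i j := fun i j => congrFun (congrFun hM i) j
  simp [det_succ_row_zero, Fin.sum_univ_succ, Fin.succAbove, pfaffianFour, hd, h 0 1, h 0 2,
    h 0 3, h 1 2, h 1 3, h 2 3]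
  ring

theorem hodgeFour_mul_self {M : Matrix (Fin 4) (Fin 4) F} (hM : Mᵀ = -M)
    (hd : ∀ i, M i i = 0) : hodgeFour M * M = -pfaffianFour M • 1 := by
  have h : ∀ i j, M j i = -M i j := fun i j => congrFun (congrFun hM i) j
  ext i j
  fin_cases i <;> fin_cases j <;>
    simp [hodgeFour, mul_apply, Fin.sum_univ_four, pfaffianFour, hd, h 0 1, h 0 2,
      h 0 3, h 1 2, h 1 3, h 2 3] <;> ring

theorem wedge_eq_zero {M : Matrix (Fin 4) (Fin 4) F} (hM : Mᵀ = -M) (hd : ∀ i, M i i = 0)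
    {a : Fin 4 → F} (ha : hodgeFour M *ᵥ a = 0) (x y z : Fin 4 → F) :
    (x ⬝ᵥ M *ᵥ y) * (a ⬝ᵥ z) + (y ⬝ᵥ M *ᵥ z) * (a ⬝ᵥ x) + (z ⬝ᵥ M *ᵥ x) * (a ⬝ᵥ y) = 0 := by
  have h : ∀ i j, M j i = -M i j := fun i j => congrFun (congrFun hM i) j
  have h0 := congrFun ha 0
  have h1 := congrFun ha 1
  have h2 := congrFun ha 2
  have h3 := congrFun ha 3
  simp [hodgeFour, mulVec, dotProduct, Fin.sum_univ_four] at h0 h1 h2 h3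
  simp only [mulVec, dotProduct, Fin.sum_univ_four, hd, h 0 1, h 0 2, h 0 3, h 1 2, h 1 3, h 2 3]
  linear_combination
    (x 1 * (y 2 * z 3 - y 3 * z 2) - x 2 * (y 1 * z 3 - y 3 * z 1)
      + x 3 * (y 1 * z 2 - y 2 * z 1)) * h0
    - (x 0 * (y 2 * z 3 - y 3 * z 2) - x 2 * (y 0 * z 3 - y 3 * z 0)
      + x 3 * (y 0 * z 2 - y 2 * z 0)) * h1
    + (x 0 * (y 1 * z 3 - y 3 * z 1) - x 1 * (y 0 * z 3 - y 3 * z 0)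
      + x 3 * (y 0 * z 1 - y 1 * z 0)) * h2
    - (x 0 * (y 1 * z 2 - y 2 * z 1) - x 1 * (y 0 * z 2 - y 2 * z 0)
      + x 2 * (y 0 * z 1 - y 1 * z 0)) * h3

/-- Two alternating forms in four variables that span a totally singular pencil have a common
linear factor. -/
theorem exists_hodgeFour_mulVec_eq_zero {M N : Matrix (Fin 4) (Fin 4) F}
    (hM : Mᵀ = -M) (hMd : ∀ i, M i i = 0) (hN : Nᵀ = -N) (hNd : ∀ i, N i i = 0)
    (hdM : M.det = 0) (hdN : N.det = 0) (hdMN : (M + N).det = 0) :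
    ∃ a : Fin 4 → F, a ≠ 0 ∧ hodgeFour M *ᵥ a = 0 ∧ hodgeFour N *ᵥ a = 0 := by
  have hself : ∀ L : Matrix (Fin 4) (Fin 4) F, Lᵀ = -L → (∀ i, L i i = 0) → L.det = 0 →
      hodgeFour L * L = 0 := by
    intro L hL hLd hdet
    rw [det_eq_pfaffianFour_sq hL hLd, sq_eq_zero_iff] at hdet
    rw [hodgeFour_mul_self hL hLd, hdet, neg_zero, zero_smul]
  have hMM := hself M hM hMd hdM
  have hNN := hself N hN hNd hdN
  have hMM' : M * hodgeFour M = 0 := by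
    simpa [transpose_mul, hodgeFour_transpose, hM] using congrArg transpose hMM
  have hMN : hodgeFour M * N + hodgeFour N * M = 0 := by
    have := hself (M + N) (by rw [transpose_add, hM, hN]; abel) (by simp [hMd, hNd]) hdMN
    rw [hodgeFour_add, add_mul, mul_add, mul_add, hMM, hNN] at this
    simpa using this
  suffices h : ∃ L : Matrix (Fin 4) (Fin 4) F,
      L ≠ 0 ∧ hodgeFour M * L = 0 ∧ hodgeFour N * L = 0 by
    obtain ⟨L, hL, h1, h2⟩ := h
    obtain ⟨j, hj⟩ : ∃ j, L.col j ≠ 0 := by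
      by_contra! h
      exact hL (ext fun i j => congrFun (h j) i)
    exact ⟨L.col j, hj, funext fun i => congrFun (congrFun h1 i) j,
      funext fun i => congrFun (congrFun h2 i) j⟩
  by_cases hP : N * hodgeFour M = 0
  · by_cases hN0 : N = 0
    · subst hN0
      by_cases hM0 : M = 0
      · exact ⟨1, one_ne_zero, by simp [hM0, hodgeFour_zero], by simp [hodgeFour_zero]⟩
      · exact ⟨M, hM0, hMM, by simp [hodgeFour_zero]⟩
    · refine ⟨N, hN0, ?_, hNN⟩
      simpa [transpose_mul, hodgeFour_transpose, hN] using congrArg transpose hP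
  · refine ⟨_, hP, ?_, by rw [← mul_assoc, hNN, zero_mul]⟩
    rw [← mul_assoc, eq_neg_of_add_eq_zero_left hMN, neg_mul, mul_assoc, hMM', mul_zero, neg_zero]

/-- Over a finite field, two functions that are additive on a hyperplane of a space of dimension
four have a common nontrivial zero there. -/
theorem exists_common_zero_of_hyperplane [Finite F] (a : Fin 4 → F) (f g : (Fin 4 → F) → F)
    (hf : ∀ x y, a ⬝ᵥ x = 0 → a ⬝ᵥ y = 0 → f (x + y) = f x + f y)
    (hg : ∀ x y, a ⬝ᵥ x = 0 → a ⬝ᵥ y = 0 → g (x + y) = g x + g y) :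
    ∃ x, x ≠ 0 ∧ a ⬝ᵥ x = 0 ∧ f x = 0 ∧ g x = 0 := by
  classical
  have := Fintype.ofFinite F
  let φ : (Fin 4 → F) →ₗ[F] F := Fintype.linearCombination F a
  have hφ : ∀ x, φ x = a ⬝ᵥ x := fun x => by
    simp [φ, Fintype.linearCombination_apply, dotProduct, mul_comm]
  have hrank : 3 ≤ Module.finrank F (LinearMap.ker φ) := by
    have h1 := LinearMap.finrank_range_add_finrank_ker φ
    have h2 := Submodule.finrank_le (LinearMap.range φ)
    rw [Module.finrank_fin_fun] at h1
    rw [Module.finrank_self] at h2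
    omega
  obtain ⟨⟨x, hx⟩, ⟨y, hy⟩, hxy, h⟩ := Fintype.exists_ne_map_eq_of_card_lt
    (fun x : LinearMap.ker φ => (f x, g x)) (by
      rw [Fintype.card_prod, ← sq, Module.card_eq_pow_finrank (K := F) (V := LinearMap.ker φ)]
      exact Nat.pow_lt_pow_right Fintype.one_lt_card (by omega))
  rw [LinearMap.mem_ker, hφ] at hx hy
  have hd : a ⬝ᵥ (x - y) = 0 := by rw [dotProduct_sub, hx, hy, sub_zero]
  have hadd : x - y + y = x := sub_add_cancel x y
  have hfx := hf _ _ hd hy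
  have hgx := hg _ _ hd hy
  simp only [Prod.mk.injEq] at h
  rw [hadd, h.1, right_eq_add] at hfx
  rw [hadd, h.2, right_eq_add] at hgx
  exact ⟨x - y, sub_ne_zero.2 fun hh => hxy (Subtype.ext hh), hd, hfx, hgx⟩

theorem exists_singular_zero_of_two_eq_zero [Finite F] (h2 : (2 : F) = 0)
    (A₁ A₂ : Matrix (Fin 4) (Fin 4) F) (hd₁ : (A₁ + A₁ᵀ).det = 0) (hd₂ : (A₂ + A₂ᵀ).det = 0)
    (hd₁₂ : (A₁ + A₁ᵀ + (A₂ + A₂ᵀ)).det = 0) :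
    ∃ x : Fin 4 → F, x ≠ 0 ∧ x ⬝ᵥ A₁ *ᵥ x = 0 ∧ x ⬝ᵥ A₂ *ᵥ x = 0 ∧
      ∃ s t : F, (s ≠ 0 ∨ t ≠ 0) ∧ s • (A₁ + A₁ᵀ) *ᵥ x = t • (A₂ + A₂ᵀ) *ᵥ x := by
  have halt : ∀ A : Matrix (Fin 4) (Fin 4) F,
      (A + Aᵀ)ᵀ = -(A + Aᵀ) ∧ ∀ i, (A + Aᵀ) i i = 0 := by
    refine fun A => ⟨?_, fun i => ?_⟩
    · ext i j
      simp only [transpose_apply, Matrix.add_apply, Matrix.neg_apply]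
      linear_combination (A i j + A j i) * h2
    · simp only [transpose_apply, Matrix.add_apply]
      linear_combination A i i * h2
  obtain ⟨a, ha, ha₁, ha₂⟩ := exists_hodgeFour_mulVec_eq_zero (halt A₁).1 (halt A₁).2
    (halt A₂).1 (halt A₂).2 hd₁ hd₂ hd₁₂
  obtain ⟨i, hi⟩ := Function.ne_iff.1 ha
  let z : Fin 4 → F := Pi.single i (a i)⁻¹
  have hz : a ⬝ᵥ z = 1 := by simpa [z] using mul_inv_cancel₀ hi
  have hadd : ∀ A : Matrix (Fin 4) (Fin 4) F, hodgeFour (A + Aᵀ) *ᵥ a = 0 →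
      ∀ x y, a ⬝ᵥ x = 0 → a ⬝ᵥ y = 0 →
        (x + y) ⬝ᵥ A *ᵥ (x + y) = x ⬝ᵥ A *ᵥ x + y ⬝ᵥ A *ᵥ y := by
    intro A hA x y hx hy
    have := wedge_eq_zero (halt A).1 (halt A).2 hA x y z
    rw [hx, hy, hz, mul_one, mul_zero, mul_zero, add_zero, add_zero] at this
    rw [polar_dotProduct_mulVec, this, add_zero]
  obtain ⟨x, hx0, hx, hx₁, hx₂⟩ := exists_common_zero_of_hyperplane a
    (fun x => x ⬝ᵥ A₁ *ᵥ x) (fun x => x ⬝ᵥ A₂ *ᵥ x) (hadd A₁ ha₁) (hadd A₂ ha₂)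
  have hgrad : ∀ A : Matrix (Fin 4) (Fin 4) F, hodgeFour (A + Aᵀ) *ᵥ a = 0 →
      ∃ c : F, (A + Aᵀ) *ᵥ x = c • a := by
    refine fun A hA => ⟨-(x ⬝ᵥ (A + Aᵀ) *ᵥ z), ?_⟩
    rw [← sub_eq_zero]
    refine dotProduct_eq_zero _ fun y => ?_
    have := wedge_eq_zero (halt A).1 (halt A).2 hA y x z
    rw [hx, hz, mul_zero, add_zero, mul_one] at this
    rw [sub_dotProduct, smul_dotProduct, smul_eq_mul, dotProduct_comm]
    linear_combination this
  obtain ⟨c₁, hc₁⟩ := hgrad A₁ ha₁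
  obtain ⟨c₂, hc₂⟩ := hgrad A₂ ha₂
  refine ⟨x, hx0, hx₁, hx₂, ?_⟩
  by_cases hc : c₁ = 0
  · exact ⟨1, 0, Or.inl one_ne_zero, by rw [hc₁, hc, zero_smul, smul_zero, zero_smul]⟩
  · exact ⟨c₂, c₁, Or.inr hc, by rw [hc₁, hc₂, smul_comm]⟩

end Alternating

open Matrix in
theorem det_pencil_eq_zero {F : Type*} [Field F] {n : ℕ} (A₁ A₂ : Matrix (Fin n) (Fin n) F)
    (hr : pencilRmax (∑ i, ∑ j, C (A₁ i j) * (X i * X j))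
      (∑ i, ∑ j, C (A₂ i j) * (X i * X j)) < n)
    {a b : AlgebraicClosure F} (hab : a ≠ 0 ∨ b ≠ 0) :
    (a • (A₁ + A₁ᵀ).map (algebraMap F (AlgebraicClosure F)) +
      b • (A₂ + A₂ᵀ).map (algebraMap F (AlgebraicClosure F))).det = 0 := by
  have h := (qRank_le_pencilRmax _ _ hab).trans_lt hr
  have hform : C a * map (algebraMap F (AlgebraicClosure F))
        (∑ i, ∑ j, C (A₁ i j) * (X i * X j)) +
      C b * map (algebraMap F (AlgebraicClosure F)) (∑ i, ∑ j, C (A₂ i j) * (X i * X j)) =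
      ∑ i, ∑ j, C ((a • A₁.map (algebraMap F (AlgebraicClosure F)) +
        b • A₂.map (algebraMap F (AlgebraicClosure F))) i j) * (X i * X j) := by
    simp only [Finset.mul_sum, map_sum, ← Finset.sum_add_distrib, map_mul, map_C, map_X,
      Matrix.add_apply, Matrix.smul_apply, Matrix.map_apply, smul_eq_mul, map_add]
    exact Finset.sum_congr rfl fun i _ => Finset.sum_congr rfl fun j _ => by ring
  rw [hform] at h
  rw [← det_add_transpose_eq_zero_of_qRank_lt _ h]
  congr 1
  ext i j
  simp only [Matrix.add_apply, Matrix.smul_apply, Matrix.map_apply, smul_eq_mul, map_add,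
    transpose_apply]
  ring

open Matrix in
/-- A pencil of matrices that is singular at every nonzero point over the algebraic closure is
singular over the polynomial ring. -/
theorem det_map_C_add_X_smul_eq_zero {F σ : Type*} [Field F] [Fintype σ] [DecidableEq σ]
    (M₁ M₂ : Matrix σ σ F)
    (h : ∀ b : AlgebraicClosure F, (M₁.map (algebraMap F (AlgebraicClosure F)) +
      b • M₂.map (algebraMap F (AlgebraicClosure F))).det = 0) :
    (M₁.map Polynomial.C + (Polynomial.X : Polynomial F) • M₂.map Polynomial.C).det = 0 := by
  have : Infinite (AlgebraicClosure F) := IsAlgClosed.instInfinite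
  apply Polynomial.map_injective _ (algebraMap F (AlgebraicClosure F)).injective
  rw [Polynomial.map_zero]
  refine Polynomial.funext fun b => ?_
  rw [Polynomial.eval_zero, Polynomial.eval_map, ← Polynomial.coe_eval₂RingHom, RingHom.map_det,
    ← h b]
  congr 1
  ext i j
  simpa using mul_comm _ _

/-- Lemma `sz`: let `q₁, q₂` be quadratic forms in 4 variables over a finite
field `F`.  If `r(q₁,q₂) < 4` then `q₁` and `q₂` have a singular common zero over `F`: a nonzero
`x ∈ F⁴` with `q₁(x) = q₂(x) = 0` whose gradients `∇q₁(x)` and `∇q₂(x)` are proportional. -/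
theorem stmt_13 {F : Type*} [Field F] [Finite F]
    (q₁ q₂ : MvPolynomial (Fin 4) F)
    (hq₁ : q₁.IsHomogeneous 2) (hq₂ : q₂.IsHomogeneous 2)
    (hr : pencilRmax q₁ q₂ < 4) :
    ∃ x : Fin 4 → F, x ≠ 0 ∧ MvPolynomial.eval x q₁ = 0 ∧ MvPolynomial.eval x q₂ = 0 ∧
      ∃ a b : F, (a ≠ 0 ∨ b ≠ 0) ∧
        ∀ j : Fin 4, a * MvPolynomial.eval x (MvPolynomial.pderiv j q₁) =
          b * MvPolynomial.eval x (MvPolynomial.pderiv j q₂) := by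
  obtain ⟨A₁, rfl⟩ := hq₁.exists_matrix_of_two
  obtain ⟨A₂, rfl⟩ := hq₂.exists_matrix_of_two
  have hdet := fun a b => det_pencil_eq_zero A₁ A₂ hr (a := a) (b := b)
  simp only [eval_sum_C_mul_X_mul_X, eval_pderiv_sum_C_mul_X_mul_X]
  by_cases h2 : (2 : F) = 0
  · have hinj : ∀ M : Matrix (Fin 4) (Fin 4) F,
        (M.map (algebraMap F (AlgebraicClosure F))).det = 0 → M.det = 0 := by
      intro M hM
      apply (algebraMap F (AlgebraicClosure F)).injective
      rw [map_zero, RingHom.map_det]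
      exact hM
    obtain ⟨x, hx0, hx₁, hx₂, s, t, hst, hx⟩ := exists_singular_zero_of_two_eq_zero h2 A₁ A₂
      (hinj _ (by
        simpa only [one_smul, zero_smul, add_zero] using hdet 1 0 (Or.inl one_ne_zero)))
      (hinj _ (by
        simpa only [one_smul, zero_smul, zero_add] using hdet 0 1 (Or.inr one_ne_zero)))
      (hinj _ (by
        rw [Matrix.map_add _ (map_add _)]
        simpa only [one_smul] using hdet 1 1 (Or.inl one_ne_zero)))
    exact ⟨x, hx0, hx₁, hx₂, s, t, hst, fun j => congrFun hx j⟩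
  · obtain ⟨x, hx0, hx₁, hx₂, hx⟩ := exists_singular_zero_of_two_ne_zero h2 A₁ A₂
      (det_map_C_add_X_smul_eq_zero _ _ fun b => by
        simpa only [one_smul] using hdet 1 b (Or.inl one_ne_zero))
    exact ⟨x, hx0, hx₁, hx₂, 1, 0, Or.inl one_ne_zero, fun j => by rw [hx]; simp⟩
end

section
/- Let s_1(X,Y) and s_2(X,Y) be binary quadratic forms over a finite field F. Suppose s_1 and s_2 have no common (linear) factor over the algebraic closure and that r(s_1,s_2) = 2. Then there are at least (1/2)(#F - 1)² pairs (a,b) in F², not both zero, for which a s_1 + b s_2 is a hyperbolic plane (equivalent over F to XY), and at least (1/2)(#F - 1)² such pairs for which a s_1 + b s_2 is anisotropic of rank 2. -/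
open MvPolynomial NumberField IsDedekindDomain

/-- The value of the binary quadratic form `a X² + b X Y + c Y²` at a point. -/
def binVal {K : Type*} [CommRing K] (a b c : K) (x : K × K) : K :=
  a * x.1 ^ 2 + b * (x.1 * x.2) + c * x.2 ^ 2

/-- The binary quadratic form `a X² + b X Y + c Y²`. -/
noncomputable def binForm {K : Type*} [CommRing K] (a b c : K) : MvPolynomial (Fin 2) K :=
  C a * X 0 ^ 2 + C b * (X 0 * X 1) + C c * X 1 ^ 2

theorem exists_eq_binForm {K : Type*} [CommRing K] {s : MvPolynomial (Fin 2) K}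
    (hs : s.IsHomogeneous 2) : ∃ a b c, s = binForm a b c := by
  refine ⟨s.coeff (Finsupp.single 0 2), s.coeff (Finsupp.single 0 1 + Finsupp.single 1 1),
    s.coeff (Finsupp.single 1 2), ?_⟩
  have h20 : (C (s.coeff (Finsupp.single 0 2)) * X 0 ^ 2 : MvPolynomial (Fin 2) K) =
      monomial (Finsupp.single 0 2) (s.coeff (Finsupp.single 0 2)) := by
    rw [X_pow_eq_monomial, C_mul_monomial, mul_one]
  have h02 : (C (s.coeff (Finsupp.single 1 2)) * X 1 ^ 2 : MvPolynomial (Fin 2) K) =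
      monomial (Finsupp.single 1 2) (s.coeff (Finsupp.single 1 2)) := by
    rw [X_pow_eq_monomial, C_mul_monomial, mul_one]
  have h11 : (C (s.coeff (Finsupp.single 0 1 + Finsupp.single 1 1)) * (X 0 * X 1) :
      MvPolynomial (Fin 2) K) = monomial (Finsupp.single 0 1 + Finsupp.single 1 1)
        (s.coeff (Finsupp.single 0 1 + Finsupp.single 1 1)) := by
    rw [X, X, monomial_mul, C_mul_monomial, mul_one, mul_one]
  rw [binForm, h20, h02, h11]
  have key : ∀ d e : Fin 2 →₀ ℕ, d = e ↔ d 0 = e 0 ∧ d 1 = e 1 := by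
    intro d e
    rw [DFunLike.ext_iff, Fin.forall_fin_two]
  ext d
  simp only [coeff_add, coeff_monomial]
  by_cases hd : s.coeff d = 0
  · rw [hd]
    split_ifs with h1 h2 h3 h3 h2 h3 h3 <;> subst_vars <;> simp_all
  · have hdeg := hs hd
    rw [Finsupp.weight_apply, Finsupp.sum_fintype _ _ (by simp)] at hdeg
    simp only [Fin.sum_univ_two, Pi.one_apply, smul_eq_mul, mul_one] at hdeg
    have h0 : d 0 = 0 ∧ d 1 = 2 ∨ d 0 = 1 ∧ d 1 = 1 ∨ d 0 = 2 ∧ d 1 = 0 := by omega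
    rcases h0 with h0 | h0 | h0
    · have : d = Finsupp.single 1 2 := by rw [key]; simp [h0]
      subst this
      simp [key]
    · have : d = Finsupp.single 0 1 + Finsupp.single 1 1 := by rw [key]; simp [h0]
      subst this
      simp [key]
    · have : d = Finsupp.single 0 2 := by rw [key]; simp [h0]
      subst this
      simp [key]

theorem eval_binForm {K : Type*} [CommRing K] (a b c : K) (x : Fin 2 → K) :
    eval x (binForm a b c) = binVal a b c (x 0, x 1) := by
  simp [binForm, binVal]

theorem map_binForm {K L : Type*} [CommRing K] [CommRing L] (f : K →+* L) (a b c : K) :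
    map f (binForm a b c) = binForm (f a) (f b) (f c) := by
  simp [binForm]

theorem map_binVal {K L : Type*} [CommRing K] [CommRing L] (f : K →+* L) (a b c : K)
    (x : K × K) : f (binVal a b c x) = binVal (f a) (f b) (f c) (f x.1, f x.2) := by
  simp [binVal]

theorem C_mul_binForm_add {K : Type*} [CommRing K] (p q a b c a' b' c' : K) :
    C p * binForm a b c + C q * binForm a' b' c' =
      binForm (p * a + q * a') (p * b + q * b') (p * c + q * c') := by
  simp only [binForm, C_add, C_mul]
  ring

theorem binVal_add {K : Type*} [CommRing K] (p q a b c a' b' c' : K) (x : K × K) :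
    binVal (p * a + q * a') (p * b + q * b') (p * c + q * c') x =
      p * binVal a b c x + q * binVal a' b' c' x := by
  simp only [binVal]
  ring

/-- The effect of a change of variables on the coefficients of a binary quadratic form. -/
theorem substMat_binForm {K : Type*} [CommRing K] (a b c : K) (u v : K × K) :
    substMat !![u.1, v.1; u.2, v.2] (binForm a b c) =
      binForm (binVal a b c u)
        (2 * a * u.1 * v.1 + b * (u.1 * v.2 + u.2 * v.1) + 2 * c * u.2 * v.2)
        (binVal a b c v) := by
  have h2 : (C 2 : MvPolynomial (Fin 2) K) = 2 := map_ofNat C 2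
  simp only [substMat, binForm, binVal, Fin.sum_univ_two, map_add, map_mul, map_pow, aeval_X,
    algHom_C, algebraMap_eq, h2]
  simp
  ring

theorem vars_binForm_zero_zero {K : Type*} [Field K] (a : K) :
    DependsOnlyOnFirst 1 (binForm a 0 0) := by
  intro i hi
  classical
  have h : binForm a 0 0 = C a * (X 0 ^ 2 : MvPolynomial (Fin 2) K) := by simp [binForm]
  rw [h] at hi
  have h1 := vars_mul _ _ hi
  rw [vars_C, Finset.empty_union] at h1
  have h2 := vars_pow _ _ h1
  rw [vars_X, Finset.mem_singleton] at h2
  simp [h2]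

theorem exists_binVal_eq_zero {K : Type*} [Field K] [IsAlgClosed K] (a b c : K) :
    ∃ x : K × K, x ≠ 0 ∧ binVal a b c x = 0 := by
  by_cases ha : a = 0
  · exact ⟨(1, 0), by simp, by simp [binVal, ha]⟩
  · obtain ⟨t, ht⟩ := IsAlgClosed.exists_root
      (Polynomial.C a * Polynomial.X ^ 2 + Polynomial.C b * Polynomial.X + Polynomial.C c)
      (by rw [Polynomial.degree_quadratic ha]; decide)
    refine ⟨(t, 1), by simp, ?_⟩
    simpa [binVal, Polynomial.IsRoot] using ht

/-- Over an algebraically closed field, a binary form of discriminant zero has rank at most 1. -/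
theorem qRank_binForm_le_one {K : Type*} [Field K] [IsAlgClosed K] {a b c : K}
    (h : b ^ 2 - 4 * a * c = 0) : qRank (binForm a b c) ≤ 1 := by
  apply Nat.sInf_le
  by_cases ha : a = 0
  · have hb : b = 0 := by simpa [ha] using h
    refine ⟨!![((0, 1) : K × K).1, ((1, 0) : K × K).1; ((0, 1) : K × K).2, ((1, 0) : K × K).2], by
      simp [Matrix.det_fin_two], ?_⟩
    rw [substMat_binForm]
    simpa [ha, hb, binVal] using vars_binForm_zero_zero c
  · obtain ⟨⟨t, s⟩, hx, hz⟩ := exists_binVal_eq_zero a b c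
    simp only [binVal] at hz
    have hs : s ≠ 0 := by
      rintro rfl
      have : t = 0 := by simpa [ha] using hz
      simp [this] at hx
    have h1 : 2 * a * t + b * s = 0 := by
      have : (2 * a * t + b * s) ^ 2 = 0 := by linear_combination 4 * a * hz + s ^ 2 * h
      simpa using this
    refine ⟨!![((1, 0) : K × K).1, (t, s).1; ((1, 0) : K × K).2, (t, s).2], by
      simpa [Matrix.det_fin_two] using hs, ?_⟩
    rw [substMat_binForm]
    have h2 : binVal a b c (t, s) = 0 := hz
    rw [h2]
    convert vars_binForm_zero_zero (binVal a b c (1, 0)) using 2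
    simp only
    linear_combination h1

/-- An anisotropic binary form has rank 2. -/
theorem qRank_binForm_of_anisotropic {K : Type*} [Field K] {a b c : K}
    (h : ∀ x : K × K, binVal a b c x = 0 → x = 0) : qRank (binForm a b c) = 2 := by
  have hne : {m | ∃ T : Matrix (Fin 2) (Fin 2) K, IsUnit T.det ∧
      DependsOnlyOnFirst m (substMat T (binForm a b c))}.Nonempty :=
    ⟨2, 1, by simp, fun i _ => i.2⟩
  apply le_antisymm
  · exact Nat.sInf_le ⟨1, by simp, fun i _ => i.2⟩
  · obtain ⟨T, hT, hd⟩ := Nat.sInf_mem hne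
    by_contra! hlt
    change qRank _ < 2 at hlt
    have hd' : DependsOnlyOnFirst 1 (substMat T (binForm a b c)) :=
      fun i hi => lt_of_lt_of_le (hd i hi) (by change qRank _ ≤ 1; omega)
    have hTe : T = !![(T 0 0, T 1 0).1, (T 0 1, T 1 1).1; (T 0 0, T 1 0).2, (T 0 1, T 1 1).2] :=
      Matrix.eta_fin_two T
    have heval : eval ![0, 1] (substMat T (binForm a b c)) =
        eval ![0, 0] (substMat T (binForm a b c)) := by
      apply eval₂Hom_congr' rfl _ rfl
      intro i hi _
      have : i = 0 := by
        have := hd' i hi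
        ext
        simp only [Fin.val_zero]
        omega
      simp [this]
    rw [hTe, substMat_binForm, eval_binForm, eval_binForm] at heval
    have hz : binVal a b c (T 0 1, T 1 1) = 0 := by simpa [binVal] using heval
    have h0 := h _ hz
    simp only [Prod.mk_eq_zero] at h0
    simp [Matrix.det_fin_two, h0] at hT

theorem exists_substMat_binForm_eq_X_mul_X {K : Type*} [Field K] {a b c : K} {u v : K × K}
    (hu : binVal a b c u = 0) (hv : binVal a b c v = 0) (huv : u.1 * v.2 - u.2 * v.1 ≠ 0)
    (hB : 2 * a * u.1 * v.1 + b * (u.1 * v.2 + u.2 * v.1) + 2 * c * u.2 * v.2 ≠ 0) :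
    ∃ T : Matrix (Fin 2) (Fin 2) K, IsUnit T.det ∧
      substMat T (binForm a b c) = X 0 * X 1 := by
  set B := 2 * a * u.1 * v.1 + b * (u.1 * v.2 + u.2 * v.1) + 2 * c * u.2 * v.2 with hBdef
  refine ⟨!![(B⁻¹ * u.1, B⁻¹ * u.2).1, v.1; (B⁻¹ * u.1, B⁻¹ * u.2).2, v.2], ?_, ?_⟩
  · have : B⁻¹ * u.1 * v.2 - v.1 * (B⁻¹ * u.2) = B⁻¹ * (u.1 * v.2 - u.2 * v.1) := by ring
    simp only [Matrix.det_fin_two_of, this, isUnit_iff_ne_zero]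
    exact mul_ne_zero (inv_ne_zero hB) huv
  · rw [substMat_binForm, hv]
    have h1 : binVal a b c (B⁻¹ * u.1, B⁻¹ * u.2) = 0 := by
      simp only [binVal] at hu ⊢
      linear_combination B⁻¹ ^ 2 * hu
    have h2 : 2 * a * (B⁻¹ * u.1) * v.1 + b * (B⁻¹ * u.1 * v.2 + B⁻¹ * u.2 * v.1) +
        2 * c * (B⁻¹ * u.2) * v.2 = 1 := by
      rw [← inv_mul_cancel₀ hB, hBdef]
      ring
    rw [h1]
    simp only [h2]
    simp [binForm]

section Counting

variable {F : Type*} [Field F] [Fintype F] [DecidableEq F]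

/-- The nonzero zeros in `F²` of a binary quadratic form. -/
def binZeros (a b c : F) : Finset (F × F) :=
  {x | x ≠ 0 ∧ binVal a b c x = 0}

/-- There are `#F - 1` nonzero vectors on a line through the origin. -/
theorem card_line {u : F × F} (hu : u ≠ 0) :
    ({x : F × F | x ≠ 0 ∧ u.1 * x.2 - u.2 * x.1 = 0} : Finset (F × F)).card =
      Fintype.card F - 1 := by
  rw [← Fintype.card_units, ← Finset.card_univ]
  symm
  obtain ⟨u1, u2⟩ := u
  refine Finset.card_bij (fun t _ => ((t : F) * u1, (t : F) * u2)) ?_ ?_ ?_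
  · intro t _
    simp only [Finset.mem_filter, Finset.mem_univ, true_and]
    refine ⟨?_, by ring⟩
    intro h
    simp only [Prod.mk_eq_zero, mul_eq_zero, t.ne_zero, false_or] at h
    simp [h] at hu
  · intro t _ t' _ h
    simp only [Prod.mk.injEq] at h
    ext
    by_cases h1 : u1 = 0
    · have h2 : u2 ≠ 0 := by
        rintro rfl
        simp [h1] at hu
      exact mul_right_cancel₀ h2 h.2
    · exact mul_right_cancel₀ h1 h.1
  · rintro ⟨x, y⟩ hx
    simp only [Finset.mem_filter, Finset.mem_univ, true_and, ne_eq, Prod.mk_eq_zero] at hx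
    obtain ⟨hx0, hx⟩ := hx
    by_cases h1 : u1 = 0
    · have h2 : u2 ≠ 0 := by
        rintro rfl
        simp [h1] at hu
      subst h1
      have hx1 : x = 0 := by simpa [h2] using hx
      have hy : y ≠ 0 := fun hy => hx0 ⟨hx1, hy⟩
      exact ⟨Units.mk0 (y / u2) (div_ne_zero hy h2), Finset.mem_univ _, by simp [hx1, h2]⟩
    · have hy : y = x / u1 * u2 := by
        field_simp
        linear_combination hx
      have hx1 : x ≠ 0 := by
        rintro rfl
        exact hx0 ⟨rfl, by simpa using hy⟩
      exact ⟨Units.mk0 (x / u1) (div_ne_zero hx1 h1), Finset.mem_univ _, by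
        simp [h1, ← hy]⟩

theorem binVal_det_sq {K : Type*} [CommRing K] (a b c : K) (u v x : K × K) :
    (u.1 * v.2 - u.2 * v.1) ^ 2 * binVal a b c x =
      (v.1 * x.2 - v.2 * x.1) ^ 2 * binVal a b c u -
      (u.1 * x.2 - u.2 * x.1) * (v.1 * x.2 - v.2 * x.1) *
        (2 * a * u.1 * v.1 + b * (u.1 * v.2 + u.2 * v.1) + 2 * c * u.2 * v.2) +
      (u.1 * x.2 - u.2 * x.1) ^ 2 * binVal a b c v := by
  simp only [binVal]
  ring

/-- A nonzero binary quadratic form over a finite field has no nontrivial zero, or its zeros form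
one line and its discriminant vanishes, or it is a hyperbolic plane and its zeros form two lines. -/
theorem card_binZeros_trichotomy {a b c : F} (h : ¬(a = 0 ∧ b = 0 ∧ c = 0)) :
    (binZeros a b c).card = 0 ∨
    ((binZeros a b c).card = Fintype.card F - 1 ∧ b ^ 2 - 4 * a * c = 0) ∨
    ((binZeros a b c).card = 2 * (Fintype.card F - 1) ∧
      ∃ T : Matrix (Fin 2) (Fin 2) F, IsUnit T.det ∧
        substMat T (binForm a b c) = X 0 * X 1) := by
  rcases (binZeros a b c).eq_empty_or_nonempty with he | ⟨u, hu⟩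
  · simp [he]
  right
  simp only [binZeros, Finset.mem_filter, Finset.mem_univ, true_and] at hu
  obtain ⟨hu0, hu⟩ := hu
  by_cases hv : ∃ v, binVal a b c v = 0 ∧ u.1 * v.2 - u.2 * v.1 ≠ 0
  · right
    obtain ⟨v, hv, huv⟩ := hv
    have hv0 : v ≠ 0 := by
      rintro rfl
      simp at huv
    have key := binVal_det_sq a b c u v
    simp only [hu, hv, mul_zero, add_zero, zero_sub] at key
    have hB : 2 * a * u.1 * v.1 + b * (u.1 * v.2 + u.2 * v.1) + 2 * c * u.2 * v.2 ≠ 0 := by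
      intro hB
      simp only [hB, mul_zero, neg_zero, mul_eq_zero, pow_eq_zero_iff two_ne_zero, huv,
        false_or] at key
      have h1 := key (1, 0)
      have h2 := key (0, 1)
      have h3 := key (1, 1)
      simp only [binVal] at h1 h2 h3
      have ha : a = 0 := by simpa using h1
      have hc : c = 0 := by simpa using h2
      exact h ⟨ha, by simpa [ha, hc] using h3, hc⟩
    refine ⟨?_, exists_substMat_binForm_eq_X_mul_X hu hv huv hB⟩
    have hun : binZeros a b c =
        ({x : F × F | x ≠ 0 ∧ u.1 * x.2 - u.2 * x.1 = 0} : Finset (F × F)) ∪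
        ({x : F × F | x ≠ 0 ∧ v.1 * x.2 - v.2 * x.1 = 0} : Finset (F × F)) := by
      ext x
      simp only [binZeros, Finset.mem_filter, Finset.mem_univ, true_and, Finset.mem_union,
        ← and_or_left, and_congr_right_iff]
      intro _
      have hx := key x
      constructor
      · intro h0
        rw [h0, mul_zero, eq_comm, neg_eq_zero] at hx
        simpa [hB] using hx
      · rintro (h0 | h0) <;> simpa [h0, huv] using hx
    rw [hun, Finset.card_union_of_disjoint, card_line hu0, card_line hv0, two_mul]
    rw [Finset.disjoint_filter]
    rintro x - ⟨hx, hxu⟩ ⟨-, hxv⟩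
    apply hx
    have e1 : (u.1 * v.2 - u.2 * v.1) * x.1 = 0 := by
      linear_combination v.1 * hxu - u.1 * hxv
    have e2 : (u.1 * v.2 - u.2 * v.1) * x.2 = 0 := by
      linear_combination v.2 * hxu - u.2 * hxv
    ext
    · simpa [huv] using e1
    · simpa [huv] using e2
  · left
    push Not at hv
    constructor
    · rw [← card_line hu0]
      congr 1
      ext x
      simp only [binZeros, Finset.mem_filter, Finset.mem_univ, true_and, and_congr_right_iff]
      intro _
      refine ⟨hv x, fun hx => ?_⟩
      simp only [binVal] at hu ⊢
      by_cases h1 : u.1 = 0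
      · have h2 : u.2 ≠ 0 := fun h2 => hu0 (Prod.ext h1 h2)
        apply mul_left_cancel₀ (pow_ne_zero 2 h2)
        linear_combination x.2 ^ 2 * hu -
          (a * (u.2 * x.1 + u.1 * x.2) + b * u.2 * x.2) * hx
      · apply mul_left_cancel₀ (pow_ne_zero 2 h1)
        linear_combination x.1 ^ 2 * hu +
          (c * (u.1 * x.2 + u.2 * x.1) + b * u.1 * x.1) * hx
    · have key : ∀ w : F × F, 2 * a * u.1 * w.1 + b * (u.1 * w.2 + u.2 * w.1) +
          2 * c * u.2 * w.2 = 0 ∨ u.1 * w.2 - u.2 * w.1 = 0 := by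
        intro w
        set B := 2 * a * u.1 * w.1 + b * (u.1 * w.2 + u.2 * w.1) + 2 * c * u.2 * w.2 with hB
        have h1 := hv (B * w.1 - binVal a b c w * u.1, B * w.2 - binVal a b c w * u.2) (by
          simp only [binVal] at hu hB ⊢
          rw [hB]
          linear_combination (a * w.1 ^ 2 + b * (w.1 * w.2) + c * w.2 ^ 2) ^ 2 * hu)
        have h2 : B * (u.1 * w.2 - u.2 * w.1) = 0 := by
          simp only at h1
          linear_combination h1
        exact mul_eq_zero.mp h2
      simp only [binVal] at hu
      by_cases h1 : u.1 = 0
      · have h2 : u.2 ≠ 0 := fun h2 => hu0 (Prod.ext h1 h2)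
        have h3 := key (1, 0)
        simp [h1, h2] at h3 hu
        simp [h3, hu]
      · have h3 := key (0, 1)
        simp only [h1, mul_zero, mul_one, zero_add, sub_zero, or_false, add_zero] at h3
        have : u.1 ^ 2 * (b ^ 2 - 4 * a * c) = 0 := by
          linear_combination (b * u.1 + 2 * c * u.2) * h3 - 4 * c * hu
        simpa [h1] using this

theorem card_binZeros_le {a b c : F} (h : ¬(a = 0 ∧ b = 0 ∧ c = 0)) :
    (binZeros a b c).card ≤ 2 * (Fintype.card F - 1) := by
  rcases card_binZeros_trichotomy h with h | h | h <;> omega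

/-- Each nonzero point of `F²` lies on exactly `#F - 1` nonzero members of the pencil. -/
theorem sum_card_binZeros {a b c a' b' c' : F}
    (h : ∀ x : F × F, x ≠ 0 → ¬(binVal a b c x = 0 ∧ binVal a' b' c' x = 0)) :
    ∑ p : F × F with p ≠ 0,
      (binZeros (p.1 * a + p.2 * a') (p.1 * b + p.2 * b') (p.1 * c + p.2 * c')).card =
    (Fintype.card F ^ 2 - 1) * (Fintype.card F - 1) := by
  have h1 : ∀ p : F × F,
      binZeros (p.1 * a + p.2 * a') (p.1 * b + p.2 * b') (p.1 * c + p.2 * c') =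
      ({x : F × F | x ≠ 0} : Finset (F × F)).filter
        (fun x => p.1 * binVal a b c x + p.2 * binVal a' b' c' x = 0) := by
    intro p
    ext x
    simp [binZeros, binVal_add]
  simp only [h1]
  have h2 := Finset.sum_card_bipartiteAbove_eq_sum_card_bipartiteBelow
    (s := ({x : F × F | x ≠ 0} : Finset (F × F))) (t := ({x : F × F | x ≠ 0} : Finset (F × F)))
    (fun p x => p.1 * binVal a b c x + p.2 * binVal a' b' c' x = 0)
  simp only [Finset.bipartiteAbove, Finset.bipartiteBelow] at h2
  rw [h2, Finset.sum_congr rfl (g := fun _ => Fintype.card F - 1), Finset.sum_const, smul_eq_mul]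
  · congr 1
    rw [Finset.filter_ne' Finset.univ (0 : F × F), Finset.card_erase_of_mem (Finset.mem_univ _),
      Finset.card_univ, Fintype.card_prod, sq]
  · intro x hx
    simp only [Finset.mem_filter, Finset.mem_univ, true_and] at hx
    rw [← card_line (u := (binVal a' b' c' x, - binVal a b c x)) (by
      intro h0
      simp only [Prod.mk_eq_zero, neg_eq_zero] at h0
      exact h x hx h0.symm), Finset.filter_filter]
    congr 1
    ext p
    simp only [Finset.mem_filter, Finset.mem_univ, true_and, and_congr_right_iff]
    intro _
    constructor <;> intro h0 <;> linear_combination h0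

/-- Counting the hyperbolic and the anisotropic members of a pencil of binary quadratic forms by
their numbers of zeros. -/
theorem sq_le_two_mul_card_binZeros {a b c a' b' c' : F}
    (h : ∀ x : F × F, x ≠ 0 → ¬(binVal a b c x = 0 ∧ binVal a' b' c' x = 0))
    (hind : ∀ p : F × F, p ≠ 0 →
      ¬(p.1 * a + p.2 * a' = 0 ∧ p.1 * b + p.2 * b' = 0 ∧ p.1 * c + p.2 * c' = 0))
    (hdisc : ¬(b ^ 2 - 4 * a * c = 0 ∧ 2 * b * b' - 4 * (a * c' + a' * c) = 0 ∧
      b' ^ 2 - 4 * a' * c' = 0)) :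
    (Fintype.card F - 1) ^ 2 ≤ 2 * ({p : F × F | p ≠ 0 ∧
      (binZeros (p.1 * a + p.2 * a') (p.1 * b + p.2 * b') (p.1 * c + p.2 * c')).card =
        2 * (Fintype.card F - 1)} : Finset (F × F)).card ∧
    (Fintype.card F - 1) ^ 2 ≤ 2 * ({p : F × F | p ≠ 0 ∧
      (binZeros (p.1 * a + p.2 * a') (p.1 * b + p.2 * b') (p.1 * c + p.2 * c')).card =
        0} : Finset (F × F)).card := by
  have hsum := sum_card_binZeros h
  have htri := fun (p : F × F) (hp : p ≠ 0) => card_binZeros_trichotomy (hind p hp)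
  set Z : F × F → ℕ := fun p =>
    (binZeros (p.1 * a + p.2 * a') (p.1 * b + p.2 * b') (p.1 * c + p.2 * c')).card with hZ
  obtain ⟨t, ht⟩ : ∃ t, Fintype.card F = t + 2 :=
    ⟨Fintype.card F - 2, by have := Fintype.one_lt_card (α := F); omega⟩
  have hcard : ({p : F × F | p ≠ 0} : Finset (F × F)).card = Fintype.card F ^ 2 - 1 := by
    rw [Finset.filter_ne' Finset.univ (0 : F × F), Finset.card_erase_of_mem (Finset.mem_univ _),
      Finset.card_univ, Fintype.card_prod, sq]
  have hsq : (t + 2) ^ 2 - 1 = (t + 1) ^ 2 + 2 * (t + 1) := by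
    rw [Nat.sub_eq_iff_eq_add (Nat.one_le_pow _ _ (by omega))]
    ring
  have hD : ({p : F × F | p ≠ 0 ∧ Z p = t + 1} : Finset (F × F)).card ≤ 2 * (t + 1) := by
    have hle := card_binZeros_le hdisc
    rw [ht] at hle
    refine le_trans (Finset.card_le_card ?_) hle
    intro p hp
    simp only [Finset.mem_filter, Finset.mem_univ, true_and, binZeros] at hp ⊢
    refine ⟨hp.1, ?_⟩
    have hp2 : (binZeros (p.1 * a + p.2 * a') (p.1 * b + p.2 * b')
      (p.1 * c + p.2 * c')).card = t + 1 := hp.2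
    have hd := htri p hp.1
    rw [hp2, ht] at hd
    rcases hd with hd | ⟨-, hd⟩ | ⟨hd, -⟩
    · omega
    · simp only [binVal]
      linear_combination hd
    · omega
  rw [ht] at hsum hcard ⊢
  rw [hsq] at hsum hcard
  simp only [show t + 2 - 1 = t + 1 from rfl] at hsum ⊢
  have hval : ∀ p ∈ ({p : F × F | p ≠ 0} : Finset (F × F)),
      Z p = 0 ∨ Z p = t + 1 ∨ Z p = 2 * (t + 1) := by
    intro p hp
    simp only [Finset.mem_filter, Finset.mem_univ, true_and] at hp
    have hd := htri p hp
    rw [ht] at hd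
    rcases hd with hd | ⟨hd, -⟩ | ⟨hd, -⟩
    · exact Or.inl hd
    · exact Or.inr (Or.inl hd)
    · exact Or.inr (Or.inr hd)
  have hsum' : ∑ p : F × F with p ≠ 0, Z p = ((t + 1) ^ 2 + 2 * (t + 1)) * (t + 1) := hsum
  rw [Finset.sum_congr rfl (g := fun p => (t + 1) *
    (2 * (if Z p = 2 * (t + 1) then 1 else 0) + if Z p = t + 1 then 1 else 0)) (fun p hp => by
      rcases hval p hp with h0 | h0 | h0 <;> (simp [h0]; try ring)),
    ← Finset.mul_sum, Finset.sum_add_distrib, ← Finset.mul_sum, ← Finset.card_filter,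
    ← Finset.card_filter, Finset.filter_filter, Finset.filter_filter, mul_comm] at hsum'
  have hsum'' := Nat.eq_of_mul_eq_mul_right (Nat.succ_pos t) hsum'
  rw [Finset.card_eq_sum_ones, Finset.sum_congr rfl (g := fun p =>
    ((if Z p = 2 * (t + 1) then 1 else 0) + if Z p = t + 1 then 1 else 0) +
      if Z p = 0 then 1 else 0) (fun p hp => by
      rcases hval p hp with h0 | h0 | h0 <;> simp [h0]),
    Finset.sum_add_distrib, Finset.sum_add_distrib, ← Finset.card_filter,
    ← Finset.card_filter, ← Finset.card_filter, Finset.filter_filter, Finset.filter_filter,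
    Finset.filter_filter] at hcard
  change (t + 1) ^ 2 ≤ 2 * ({p : F × F | p ≠ 0 ∧ Z p = 2 * (t + 1)} : Finset (F × F)).card ∧
    (t + 1) ^ 2 ≤ 2 * ({p : F × F | p ≠ 0 ∧ Z p = 0} : Finset (F × F)).card
  constructor <;> omega

end Counting

/-- If `r(s₁,s₂) = 2`, the discriminant does not vanish identically on the pencil. -/
theorem disc_ne_zero_of_pencilRmax_eq_two {F : Type*} [Field F] {a b c a' b' c' : F}
    (hr : pencilRmax (binForm a b c) (binForm a' b' c') = 2) :
    ¬(b ^ 2 - 4 * a * c = 0 ∧ 2 * b * b' - 4 * (a * c' + a' * c) = 0 ∧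
      b' ^ 2 - 4 * a' * c' = 0) := by
  rintro ⟨h1, h2, h3⟩
  have hle : pencilRmax (binForm a b c) (binForm a' b' c') ≤ 1 := by
    refine csSup_le ⟨_, 1, 0, Or.inl one_ne_zero, rfl⟩ ?_
    rintro m ⟨p, q, -, rfl⟩
    rw [map_binForm, map_binForm, C_mul_binForm_add]
    apply qRank_binForm_le_one
    have e1 := congrArg (algebraMap F (AlgebraicClosure F)) h1
    have e2 := congrArg (algebraMap F (AlgebraicClosure F)) h2
    have e3 := congrArg (algebraMap F (AlgebraicClosure F)) h3
    simp only [map_sub, map_add, map_mul, map_pow, map_ofNat, map_zero] at e1 e2 e3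
    linear_combination p ^ 2 * e1 + p * q * e2 + q ^ 2 * e3
  omega

/-- Lemma `2N`: let `s₁, s₂` be binary quadratic forms over a finite field `F`
with no common zero (equivalently, no common linear factor) over the algebraic closure, and with
`r(s₁,s₂) = 2`.  Then at least `(#F-1)²/2` nonzero pairs `(a,b) ∈ F²` make `as₁ + bs₂` a
hyperbolic plane, and at least `(#F-1)²/2` nonzero pairs make it anisotropic of rank 2. -/
theorem stmt_14 {F : Type*} [Field F] [Finite F]
    (s₁ s₂ : MvPolynomial (Fin 2) F)
    (hs₁ : s₁.IsHomogeneous 2) (hs₂ : s₂.IsHomogeneous 2)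
    (hnocommon : ¬ ∃ x : Fin 2 → AlgebraicClosure F, x ≠ 0 ∧
      MvPolynomial.eval x (MvPolynomial.map (algebraMap F (AlgebraicClosure F)) s₁) = 0 ∧
      MvPolynomial.eval x (MvPolynomial.map (algebraMap F (AlgebraicClosure F)) s₂) = 0)
    (hr : pencilRmax s₁ s₂ = 2) :
    (Nat.card F - 1) ^ 2 ≤ 2 * Nat.card {p : F × F // p ≠ 0 ∧
        ∃ T : Matrix (Fin 2) (Fin 2) F, IsUnit T.det ∧
          substMat T (MvPolynomial.C p.1 * s₁ + MvPolynomial.C p.2 * s₂) =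
            MvPolynomial.X 0 * MvPolynomial.X 1} ∧
    (Nat.card F - 1) ^ 2 ≤ 2 * Nat.card {p : F × F // p ≠ 0 ∧
        qRank (MvPolynomial.C p.1 * s₁ + MvPolynomial.C p.2 * s₂) = 2 ∧
        ∀ x : Fin 2 → F,
          MvPolynomial.eval x (MvPolynomial.C p.1 * s₁ + MvPolynomial.C p.2 * s₂) = 0 →
            x = 0} := by
  classical
  have := Fintype.ofFinite F
  obtain ⟨a, b, c, rfl⟩ := exists_eq_binForm hs₁
  obtain ⟨a', b', c', rfl⟩ := exists_eq_binForm hs₂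
  simp only [map_binForm, eval_binForm] at hnocommon
  have hno : ∀ x : AlgebraicClosure F × AlgebraicClosure F, x ≠ 0 →
      ¬(binVal (algebraMap F (AlgebraicClosure F) a) (algebraMap F _ b) (algebraMap F _ c) x = 0 ∧
        binVal (algebraMap F (AlgebraicClosure F) a') (algebraMap F _ b') (algebraMap F _ c') x =
          0) := by
    rintro ⟨x, y⟩ hx ⟨h1, h2⟩
    refine hnocommon ⟨![x, y], fun h0 => hx ?_, h1, h2⟩
    exact Prod.ext (congrFun h0 0) (congrFun h0 1)
  have h : ∀ x : F × F, x ≠ 0 → ¬(binVal a b c x = 0 ∧ binVal a' b' c' x = 0) := by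
    rintro x hx ⟨h1, h2⟩
    refine hno (algebraMap F _ x.1, algebraMap F _ x.2) (fun h0 => hx ?_)
      ⟨by rw [← map_binVal, h1, map_zero], by rw [← map_binVal, h2, map_zero]⟩
    simp only [Prod.mk_eq_zero, map_eq_zero] at h0
    exact Prod.ext h0.1 h0.2
  have hind : ∀ p : F × F, p ≠ 0 →
      ¬(p.1 * a + p.2 * a' = 0 ∧ p.1 * b + p.2 * b' = 0 ∧ p.1 * c + p.2 * c' = 0) := by
    rintro p hp ⟨h1, h2, h3⟩
    have e1 := congrArg (algebraMap F (AlgebraicClosure F)) h1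
    have e2 := congrArg (algebraMap F (AlgebraicClosure F)) h2
    have e3 := congrArg (algebraMap F (AlgebraicClosure F)) h3
    simp only [map_add, map_mul, map_zero] at e1 e2 e3
    have hcomb := binVal_add (algebraMap F (AlgebraicClosure F) p.1) (algebraMap F _ p.2)
      (algebraMap F _ a) (algebraMap F _ b) (algebraMap F _ c)
      (algebraMap F _ a') (algebraMap F _ b') (algebraMap F _ c')
    rw [e1, e2, e3] at hcomb
    have hzero : ∀ y : AlgebraicClosure F × AlgebraicClosure F, binVal 0 0 0 y = 0 := by
      simp [binVal]
    simp only [hzero] at hcomb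
    by_cases hp1 : p.1 = 0
    · have hp2 : p.2 ≠ 0 := fun hp2 => hp (Prod.ext hp1 hp2)
      obtain ⟨y, hy, hy1⟩ := exists_binVal_eq_zero
        (algebraMap F (AlgebraicClosure F) a) (algebraMap F _ b) (algebraMap F _ c)
      exact hno y hy ⟨hy1, by simpa [hy1, hp2] using hcomb y⟩
    · obtain ⟨y, hy, hy1⟩ := exists_binVal_eq_zero
        (algebraMap F (AlgebraicClosure F) a') (algebraMap F _ b') (algebraMap F _ c')
      exact hno y hy ⟨by simpa [hy1, hp1] using hcomb y, hy1⟩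
  obtain ⟨hH, hN⟩ := sq_le_two_mul_card_binZeros h hind (disc_ne_zero_of_pencilRmax_eq_two hr)
  have hq := Fintype.one_lt_card (α := F)
  simp only [C_mul_binForm_add, eval_binForm, Nat.card_eq_fintype_card, Fintype.card_subtype]
  refine ⟨hH.trans (Nat.mul_le_mul_left 2 (Finset.card_le_card fun p hp => ?_)),
    hN.trans (Nat.mul_le_mul_left 2 (Finset.card_le_card fun p hp => ?_))⟩
  · simp only [Finset.mem_filter, Finset.mem_univ, true_and] at hp ⊢
    refine ⟨hp.1, ?_⟩
    rcases card_binZeros_trichotomy (hind p hp.1) with h0 | ⟨h0, -⟩ | ⟨-, h0⟩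
    · omega
    · omega
    · exact h0
  · simp only [Finset.mem_filter, Finset.mem_univ, true_and, Finset.card_eq_zero] at hp ⊢
    have han : ∀ x : F × F, binVal (p.1 * a + p.2 * a') (p.1 * b + p.2 * b')
        (p.1 * c + p.2 * c') x = 0 → x = 0 := by
      intro x hx
      by_contra hx0
      have : x ∈ binZeros (p.1 * a + p.2 * a') (p.1 * b + p.2 * b') (p.1 * c + p.2 * c') := by
        simp [binZeros, hx0, hx]
      simp [hp.2] at this
    refine ⟨hp.1, qRank_binForm_of_anisotropic han, fun x hx => ?_⟩
    have h0 := han _ hx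
    simp only [Prod.mk_eq_zero] at h0
    funext i
    fin_cases i
    · exact h0.1
    · exact h0.2
end
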